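/- arXiv:1210.4229 — 4 statements merged into one kernel-verified Lean document; each statement's English description precedes it below -/
import Mathlib

section
/- Let N ≥ 2 and let γ : [0,1] → ℝ^N be three times continuously differentiable with γ'(t) ≠ 0 for all t, injective except possibly γ(0) = γ(1), and with γ'(0) = γ'(1) in case γ(0) = γ(1). For R > 0 define Ω_R := interior( ⋃_{t ∈ [0,1]} {Rγ(t) + v : v ∈ ℝ^N, |v| < 1, γ'(t)·v = 0} ). Define λ_{1,1} := inf { ∫ |∇u|² / ∫ u² : u smooth with compact support in the open unit ball B₁^{N−1} of ℝ^{N−1}, u not identically 0 }. If λ > −λ_{1,1}, then there exists R₀ > 0 such that for every R ≥ R₀ there is a function W, twice continuously differentiable on Ω_R and continuous on the closure of Ω_R, with min_{closure(Ω_R)} W > 0 and −ΔW(x) + λW(x) > 0 for every x ∈ Ω_R. -/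
open MeasureTheory
open scoped RealInnerProductSpace

/-- The bottom of the Dirichlet spectrum of `-Δ` on an open set `U`, characterized as the
infimum of the Rayleigh quotient over nonzero smooth compactly supported functions in `U`. -/
noncomputable def rayleighQuotientInf {N : ℕ} (U : Set (EuclideanSpace ℝ (Fin N))) : ℝ :=
  ⨅ u : {u : EuclideanSpace ℝ (Fin N) → ℝ //
      ContDiff ℝ (⊤ : ℕ∞) u ∧ HasCompactSupport u ∧ tsupport u ⊆ U ∧ u ≠ 0},
    (∫ x, ‖fderiv ℝ u.1 x‖ ^ 2) / (∫ x, (u.1 x) ^ 2)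

/-- The Laplacian of `W`, the trace of the Hessian, i.e. the sum of the pure second partial
derivatives in the coordinate directions. -/
noncomputable def laplacian {N : ℕ} (W : EuclideanSpace ℝ (Fin N) → ℝ)
    (x : EuclideanSpace ℝ (Fin N)) : ℝ :=
  ∑ i : Fin N,
    iteratedFDeriv ℝ 2 W x ![EuclideanSpace.single i (1 : ℝ), EuclideanSpace.single i (1 : ℝ)]

/-- The open normal tubular neighborhood of radius `1` of the expanded curve `R • γ`:
`Ω_R = int ⋃_{t ∈ [0,1]} {Rγ(t) + v : |v| < 1, γ'(t)·v = 0}`. -/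
noncomputable def tubularNbhd {N : ℕ} (γ : ℝ → EuclideanSpace ℝ (Fin N)) (R : ℝ) :
    Set (EuclideanSpace ℝ (Fin N)) :=
  interior (⋃ t ∈ Set.Icc (0 : ℝ) 1,
    {y | ∃ v : EuclideanSpace ℝ (Fin N),
      y = R • γ t + v ∧ ‖v‖ < 1 ∧ ⟪derivWithin γ (Set.Icc 0 1) t, v⟫ = 0})

open scoped ContDiff

lemma abs_succ_mul_coeff_succ_le {b : ℕ → ℝ} {A C : ℝ}
    (hb : ∀ k, |b k| ≤ A * (C ^ k / k.factorial)) (k : ℕ) :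
    |((k : ℝ) + 1) * b (k + 1)| ≤ A * C * (C ^ k / k.factorial) := by
  have h := hb (k + 1)
  rw [Nat.factorial_succ] at h
  push_cast at h
  have hk : (0 : ℝ) < k + 1 := by positivity
  have hf : (0 : ℝ) < k.factorial := by positivity
  rw [abs_mul, abs_of_pos hk]
  calc ((k : ℝ) + 1) * |b (k + 1)|
      ≤ (k + 1) * (A * (C ^ (k + 1) / ((k + 1) * k.factorial))) := by gcongr
    _ = A * C * (C ^ k / k.factorial) := by field_simp; ring

/-- The sum `∑ b k * s ^ k` is differentiated termwise when the coefficients decay like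
`C ^ k / k !`. -/
lemma hasDerivAt_tsum_coeff_mul_pow {b : ℕ → ℝ} {A C : ℝ}
    (hb : ∀ k, |b k| ≤ A * (C ^ k / k.factorial)) (s : ℝ) :
    HasDerivAt (fun s : ℝ => ∑' k, b k * s ^ k) (∑' k, ((k + 1) * b (k + 1)) * s ^ k) s := by
  obtain ⟨r, hr⟩ : ∃ r : ℝ, |s| < r := ⟨|s| + 1, by linarith⟩
  have hr0 : 0 < r := (abs_nonneg s).trans_lt hr
  have hb' : ∀ k : ℕ, ((k : ℝ) + 1) * |b (k + 1)| ≤ A * C * (C ^ k / k.factorial) := fun k => by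
    have hk : (0 : ℝ) < k + 1 := by positivity
    simpa [abs_mul, abs_of_pos hk] using abs_succ_mul_coeff_succ_le hb k
  have hsum : Summable fun k : ℕ => A * C * ((C * r) ^ k / k.factorial) :=
    (Real.summable_pow_div_factorial (C * r)).mul_left _
  have hu : Summable fun k : ℕ => (k : ℝ) * |b k| * r ^ (k - 1) := by
    rw [← summable_nat_add_iff 1]
    refine Summable.of_nonneg_of_le (fun k => by positivity) (fun k => ?_) hsum
    have := mul_le_mul_of_nonneg_right (hb' k) (pow_nonneg hr0.le k)
    push_cast
    rw [mul_pow]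
    refine this.trans (le_of_eq ?_)
    ring
  have hmem : s ∈ Metric.ball (0 : ℝ) r := by simpa using hr
  have key := hasDerivAt_tsum_of_isPreconnected (g := fun (k : ℕ) (s : ℝ) => b k * s ^ k)
    (g' := fun (k : ℕ) (s : ℝ) => b k * (k * s ^ (k - 1))) hu Metric.isOpen_ball
    (convex_ball (0 : ℝ) r).isPreconnected
    (fun k y _ => (hasDerivAt_pow k y).const_mul (b k))
    (fun k y hy => by
      have hy' : |y| ≤ r := by simpa using (Metric.mem_ball.1 hy).le
      rw [Real.norm_eq_abs, abs_mul, abs_mul, abs_pow, Nat.abs_cast]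
      calc |b k| * (k * |y| ^ (k - 1)) ≤ |b k| * (k * r ^ (k - 1)) := by gcongr
        _ = _ := by ring)
    (Metric.mem_ball_self hr0) (by
      refine summable_of_ne_finset_zero (s := {0}) fun k hk => ?_
      simp at hk
      simp [hk]) hmem
  refine key.congr_deriv ?_
  have hs : Summable fun k : ℕ => b k * (k * s ^ (k - 1)) := by
    refine Summable.of_norm_bounded hu fun k => ?_
    rw [Real.norm_eq_abs, abs_mul, abs_mul, abs_pow, Nat.abs_cast]
    calc |b k| * (k * |s| ^ (k - 1)) ≤ |b k| * (k * r ^ (k - 1)) := by gcongr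
      _ = _ := by ring
  rw [hs.tsum_eq_zero_add]
  simp
  congr 1; ext k; ring

lemma summable_coeff_mul_pow {b : ℕ → ℝ} {A C : ℝ}
    (hb : ∀ k, |b k| ≤ A * (C ^ k / k.factorial)) (s : ℝ) :
    Summable fun k => b k * s ^ k := by
  refine Summable.of_norm_bounded
    ((Real.summable_pow_div_factorial (C * |s|)).mul_left A) fun k => ?_
  rw [Real.norm_eq_abs, abs_mul, abs_pow]
  calc |b k| * |s| ^ k ≤ A * (C ^ k / k.factorial) * |s| ^ k := by gcongr; exact hb k
    _ = _ := by rw [mul_pow]; ring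

lemma contDiff_tsum_coeff_mul_pow {b : ℕ → ℝ} {A C : ℝ}
    (hb : ∀ k, |b k| ≤ A * (C ^ k / k.factorial)) :
    ContDiff ℝ ∞ (fun s : ℝ => ∑' k, b k * s ^ k) := by
  rw [contDiff_infty]
  intro n
  induction n generalizing b A with
  | zero =>
    exact contDiff_zero.2 <| continuous_iff_continuousAt.2
      fun s => (hasDerivAt_tsum_coeff_mul_pow hb s).continuousAt
  | succ n ih =>
    push_cast
    rw [contDiff_succ_iff_deriv]
    refine ⟨fun s => (hasDerivAt_tsum_coeff_mul_pow hb s).differentiableAt, by simp, ?_⟩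
    rw [funext fun s => (hasDerivAt_tsum_coeff_mul_pow hb s).deriv]
    exact ih (abs_succ_mul_coeff_succ_le hb)

/-- The radial eigenvalue equation `Δφ + μφ = 0` in dimension `d`, written for `φ x = f (‖x‖²)`,
has a smooth solution with `f 0 = 1`. -/
lemma exists_radial_eigenfunction {d : ℕ} (hd : 1 ≤ d) (μ : ℝ) :
    ∃ f : ℝ → ℝ, ContDiff ℝ ∞ f ∧ f 0 = 1 ∧
      ∀ s, 4 * s * deriv (deriv f) s + 2 * d * deriv f s + μ * f s = 0 := by
  let a : ℕ → ℝ := fun k => Nat.rec 1 (fun k x => -μ * x / (2 * (k + 1) * (2 * k + d))) k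
  have a0 : a 0 = 1 := rfl
  have d1 : (1 : ℝ) ≤ d := by exact_mod_cast hd
  have a_succ : ∀ k : ℕ, 2 * ((k : ℝ) + 1) * (2 * k + d) * a (k + 1) = -μ * a k := by
    intro k
    have h : a (k + 1) = -μ * a k / (2 * (k + 1) * (2 * k + d)) := rfl
    rw [h, mul_div_cancel₀]
    positivity
  have ha : ∀ k, |a k| ≤ 1 * (|μ| ^ k / k.factorial) := by
    intro k
    induction k with
    | zero => simp [a0]
    | succ k ih =>
      have hk : (0 : ℝ) < k + 1 := by positivity
      have hf : (0 : ℝ) < k.factorial := by positivity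
      have h := congrArg abs (a_succ k)
      rw [abs_mul, abs_mul (-μ), abs_neg, abs_of_pos (by positivity)] at h
      have h2 : ((k : ℝ) + 1) * |a (k + 1)| ≤ |μ| * |a k| := by
        rw [← h]
        gcongr
        nlinarith [(Nat.cast_nonneg k : (0 : ℝ) ≤ k)]
      rw [Nat.factorial_succ]
      push_cast
      rw [one_mul] at ih ⊢
      rw [le_div_iff₀ (by positivity)]
      calc |a (k + 1)| * ((k + 1) * k.factorial) = ((k : ℝ) + 1) * |a (k + 1)| * k.factorial := by
            ring
        _ ≤ |μ| * |a k| * k.factorial := by gcongr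
        _ ≤ |μ| * (|μ| ^ k / k.factorial) * k.factorial := by gcongr
        _ = |μ| ^ (k + 1) := by field_simp; ring
  have ha1 := abs_succ_mul_coeff_succ_le ha
  have ha2 : ∀ k : ℕ, |((k : ℝ) + 1) * (((k + 1 : ℕ) + 1) * a (k + 1 + 1))| ≤ _ :=
    abs_succ_mul_coeff_succ_le (b := fun k => ((k : ℝ) + 1) * a (k + 1)) ha1
  refine ⟨fun s => ∑' k, a k * s ^ k, contDiff_tsum_coeff_mul_pow ha, ?_, fun s => ?_⟩
  · change ∑' k, a k * (0 : ℝ) ^ k = 1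
    rw [tsum_eq_single 0 fun k hk => by simp [hk]]
    simp [a0]
  · rw [funext fun s => (hasDerivAt_tsum_coeff_mul_pow ha s).deriv]
    rw [(hasDerivAt_tsum_coeff_mul_pow (b := fun k => ((k : ℝ) + 1) * a (k + 1)) ha1 s).deriv]
    have S0 := summable_coeff_mul_pow ha s
    have S1 := summable_coeff_mul_pow ha1 s
    have S2 := summable_coeff_mul_pow ha2 s
    have S3 : Summable fun k : ℕ => (k : ℝ) * ((k + 1) * a (k + 1)) * s ^ k := by
      rw [← summable_nat_add_iff 1]
      refine (S2.mul_left s).congr fun k => ?_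
      push_cast; ring
    have e : s * ∑' k : ℕ, ((k : ℝ) + 1) * (((k + 1 : ℕ) + 1) * a (k + 1 + 1)) * s ^ k =
        ∑' k : ℕ, (k : ℝ) * ((k + 1) * a (k + 1)) * s ^ k := by
      rw [S3.tsum_eq_zero_add, ← tsum_mul_left]
      simp
      congr 1; ext k; ring
    rw [mul_assoc, e, ← tsum_mul_left, ← tsum_mul_left, ← tsum_mul_left,
      ← (S3.mul_left 4).tsum_add (S1.mul_left _),
      ← ((S3.mul_left 4).add (S1.mul_left _)).tsum_add (S0.mul_left _)]
    refine (tsum_congr fun k => ?_).trans tsum_zero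
    linear_combination s ^ k * a_succ k

lemma hasFDerivAt_comp_norm_sq {E : Type*} [NormedAddCommGroup E] [InnerProductSpace ℝ E]
    {F : ℝ → ℝ} (hF : Differentiable ℝ F) (x : E) :
    HasFDerivAt (fun x : E => F (‖x‖ ^ 2)) ((2 * deriv F (‖x‖ ^ 2)) • innerSL ℝ x) x := by
  have h := (hF (‖x‖ ^ 2)).hasDerivAt.comp_hasFDerivAt x (hasStrictFDerivAt_norm_sq x).hasFDerivAt
  refine h.congr_fderiv ?_
  rw [mul_comm, mul_smul, two_smul ℕ, two_smul ℝ]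

lemma hasCompactSupport_comp_norm_sq {E : Type*} [NormedAddCommGroup E] [ProperSpace E]
    {F : ℝ → ℝ} (hF1 : ∀ s, 1 ≤ s → F s = 0) :
    HasCompactSupport (fun x : E => F (‖x‖ ^ 2)) :=
  HasCompactSupport.intro (isCompact_closedBall (0 : E) 1) fun x hx => by
    rw [mem_closedBall_zero_iff, not_le] at hx
    exact hF1 _ (one_le_pow₀ hx.le)

/-- The divergence theorem for the compactly supported radial vector field `x ↦ F (‖x‖²) x`. -/
lemma integral_divergence_radial_eq_zero {d : ℕ} {F : ℝ → ℝ} (hF : ContDiff ℝ 1 F)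
    (hF1 : ∀ s, 1 ≤ s → F s = 0) :
    ∫ x : EuclideanSpace ℝ (Fin d), (2 * ‖x‖ ^ 2 * deriv F (‖x‖ ^ 2) + d * F (‖x‖ ^ 2)) = 0 := by
  have hF' : Continuous (deriv F) := hF.continuous_deriv le_rfl
  have hcs := hasCompactSupport_comp_norm_sq (E := EuclideanSpace ℝ (Fin d)) hF1
  have hF1' : ∀ s, 1 ≤ s → deriv F s = 0 := by
    intro s hs
    have h : ∀ s ∈ Set.Ioi (1 : ℝ), deriv F s = 0 := fun s hs => by
      have : F =ᶠ[nhds s] fun _ => 0 := by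
        filter_upwards [Ioi_mem_nhds hs] with y hy using hF1 y (le_of_lt hy)
      simp [this.deriv_eq]
    have hcl : IsClosed {s | deriv F s = 0} := isClosed_eq hF' continuous_const
    exact closure_minimal h hcl (by rw [closure_Ioi]; exact hs)
  have hcs' := hasCompactSupport_comp_norm_sq (E := EuclideanSpace ℝ (Fin d)) hF1'
  have hFc := hF.continuous
  have hint0 : Integrable fun x : EuclideanSpace ℝ (Fin d) => F (‖x‖ ^ 2) :=
    Continuous.integrable_of_hasCompactSupport (by fun_prop) hcs
  have hint2 : ∀ i, Integrable fun x : EuclideanSpace ℝ (Fin d) =>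
      x i * (2 * deriv F (‖x‖ ^ 2) * x i) := fun i => by
    refine Continuous.integrable_of_hasCompactSupport (by fun_prop) (hcs'.mono ?_)
    intro x hx hx'
    simp only at hx'
    exact hx (by simp [hx'])
  have key : ∀ i : Fin d, ∫ x : EuclideanSpace ℝ (Fin d), x i * (2 * deriv F (‖x‖ ^ 2) * x i) =
      - ∫ x : EuclideanSpace ℝ (Fin d), F (‖x‖ ^ 2) := by
    intro i
    have hfd : ∀ x : EuclideanSpace ℝ (Fin d),
        fderiv ℝ (fun x : EuclideanSpace ℝ (Fin d) => F (‖x‖ ^ 2)) x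
          (EuclideanSpace.single i 1) = 2 * deriv F (‖x‖ ^ 2) * x i := fun x => by
      rw [(hasFDerivAt_comp_norm_sq (hF.differentiable one_ne_zero) x).fderiv]
      simp [EuclideanSpace.inner_single_right]
    have hpr : ∀ x : EuclideanSpace ℝ (Fin d),
        fderiv ℝ (fun x : EuclideanSpace ℝ (Fin d) => x i) x (EuclideanSpace.single i 1) = 1 :=
      fun x => by
        have h : HasFDerivAt (fun x : EuclideanSpace ℝ (Fin d) => x i)
            (EuclideanSpace.proj i : EuclideanSpace ℝ (Fin d) →L[ℝ] ℝ) x :=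
          (EuclideanSpace.proj i : EuclideanSpace ℝ (Fin d) →L[ℝ] ℝ).hasFDerivAt
        rw [h.fderiv]
        simp
    have h := integral_mul_fderiv_eq_neg_fderiv_mul_of_integrable (μ := volume)
      (f := fun x : EuclideanSpace ℝ (Fin d) => x i) (g := fun x => F (‖x‖ ^ 2))
      (v := EuclideanSpace.single i 1) (by simpa [hpr] using hint0) (by simpa [hfd] using hint2 i)
      (Continuous.integrable_of_hasCompactSupport (by fun_prop) (hcs.mul_left))
      (fun x _ => by fun_prop)
      (fun x _ => (hasFDerivAt_comp_norm_sq (hF.differentiable one_ne_zero) x).differentiableAt)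
    simpa [hpr, hfd] using h
  have hsum : ∀ x : EuclideanSpace ℝ (Fin d),
      2 * ‖x‖ ^ 2 * deriv F (‖x‖ ^ 2) = ∑ i, x i * (2 * deriv F (‖x‖ ^ 2) * x i) := fun x => by
    rw [EuclideanSpace.real_norm_sq_eq, Finset.mul_sum, Finset.sum_mul]
    exact Finset.sum_congr rfl fun i _ => by ring
  have hI : Integrable fun x : EuclideanSpace ℝ (Fin d) => 2 * ‖x‖ ^ 2 * deriv F (‖x‖ ^ 2) := by
    simp_rw [hsum]
    exact integrable_finsetSum _ fun i _ => hint2 i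
  rw [integral_add hI (hint0.const_mul _), integral_const_mul]
  simp_rw [hsum]
  rw [integral_finsetSum _ fun i _ => hint2 i]
  simp [key]

lemma rayleighQuotientInf_mul_le {d : ℕ} {U : Set (EuclideanSpace ℝ (Fin d))}
    {u : EuclideanSpace ℝ (Fin d) → ℝ} (hu : ContDiff ℝ (⊤ : ℕ∞) u) (hc : HasCompactSupport u)
    (hU : tsupport u ⊆ U) :
    rayleighQuotientInf U * ∫ x, u x ^ 2 ≤ ∫ x, ‖fderiv ℝ u x‖ ^ 2 := by
  have h1 : 0 ≤ ∫ x, ‖fderiv ℝ u x‖ ^ 2 := integral_nonneg fun x => by positivity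
  rcases (integral_nonneg fun x => sq_nonneg (u x) : 0 ≤ ∫ x, u x ^ 2).eq_or_lt with h | h
  · rw [← h, mul_zero]; exact h1
  · have hne : u ≠ 0 := by rintro rfl; simp at h
    rw [← le_div_iff₀ h]
    refine ciInf_le (f := fun u : {u : EuclideanSpace ℝ (Fin d) → ℝ //
      ContDiff ℝ (⊤ : ℕ∞) u ∧ HasCompactSupport u ∧ tsupport u ⊆ U ∧ u ≠ 0} =>
      (∫ x, ‖fderiv ℝ u.1 x‖ ^ 2) / (∫ x, (u.1 x) ^ 2)) ⟨0, ?_⟩ ⟨u, hu, hc, hU, hne⟩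
    rintro _ ⟨v, rfl⟩
    exact div_nonneg (integral_nonneg fun x => by positivity)
      (integral_nonneg fun x => by positivity)

/-- Ground state substitution for a radial eigenfunction times a radial cutoff. -/
lemma rayleighQuotientInf_sub_mul_integral_le {d : ℕ} {μ r : ℝ} {f ξ : ℝ → ℝ}
    (hf : ContDiff ℝ ∞ f)
    (ode : ∀ s, 4 * s * deriv (deriv f) s + 2 * d * deriv f s + μ * f s = 0)
    (hξ : ContDiff ℝ ∞ ξ) (hr : r < 1) (hξr : ∀ s, r ≤ s → ξ s = 0) :
    (rayleighQuotientInf (Metric.ball (0 : EuclideanSpace ℝ (Fin d)) 1) - μ) *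
        ∫ x : EuclideanSpace ℝ (Fin d), (f (‖x‖ ^ 2) * ξ (‖x‖ ^ 2)) ^ 2 ≤
      ∫ x : EuclideanSpace ℝ (Fin d), 4 * ‖x‖ ^ 2 * (f (‖x‖ ^ 2) * deriv ξ (‖x‖ ^ 2)) ^ 2 := by
  have hf' : ContDiff ℝ ∞ (deriv f) := (contDiff_infty_iff_deriv.1 hf).2
  have df := hf.differentiable (by simp)
  have df' := hf'.differentiable (by simp)
  have dξ := hξ.differentiable (by simp)
  have cξ' : Continuous (deriv ξ) := hξ.continuous_deriv (by simp)
  set g : ℝ → ℝ := fun s => f s * ξ s with hg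
  set F : ℝ → ℝ := fun s => 2 * f s * deriv f s * ξ s ^ 2 with hFdef
  have hgs : ContDiff ℝ ∞ g := hf.mul hξ
  have hFs : ContDiff ℝ ∞ F := ((contDiff_const.mul hf).mul hf').mul (hξ.pow 2)
  have dg : ∀ s, deriv g s = deriv f s * ξ s + f s * deriv ξ s := fun s =>
    ((df s).hasDerivAt.mul (dξ s).hasDerivAt).deriv
  have dF : ∀ s, deriv F s = (2 * deriv f s * deriv f s + 2 * f s * deriv (deriv f) s) * ξ s ^ 2 +
      2 * f s * deriv f s * (2 * ξ s * deriv ξ s) := fun s => by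
    have := ((((df s).hasDerivAt.const_mul 2).mul (df' s).hasDerivAt).mul
      ((dξ s).hasDerivAt.pow 2)).deriv
    refine Eq.trans this ?_
    simp
  set u : EuclideanSpace ℝ (Fin d) → ℝ := fun x => g (‖x‖ ^ 2) with hu
  have hus : ContDiff ℝ (⊤ : ℕ∞) u := hgs.comp (contDiff_norm_sq ℝ)
  have hg1 : ∀ s, 1 ≤ s → g s = 0 := fun s hs => by simp [hg, hξr s (hr.le.trans hs)]
  have huc : HasCompactSupport u := hasCompactSupport_comp_norm_sq hg1
  have huU : tsupport u ⊆ Metric.ball 0 1 := by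
    refine (closure_minimal (t := {x : EuclideanSpace ℝ (Fin d) | ‖x‖ ^ 2 ≤ r}) (fun x hx => ?_)
      (isClosed_le (by fun_prop) continuous_const)).trans fun x hx => ?_
    · by_contra hxr
      exact hx (by simp [hu, hg, hξr _ (not_le.1 hxr).le])
    · rw [mem_ball_zero_iff]
      have : ‖x‖ ^ 2 < 1 := lt_of_le_of_lt hx hr
      nlinarith [norm_nonneg x]
  have hmain := rayleighQuotientInf_mul_le hus huc huU
  have hgrad : ∀ x, ‖fderiv ℝ u x‖ ^ 2 = 4 * ‖x‖ ^ 2 * deriv g (‖x‖ ^ 2) ^ 2 := fun x => by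
    rw [(hasFDerivAt_comp_norm_sq (hgs.differentiable (by simp)) x).fderiv, norm_smul,
      innerSL_apply_norm, mul_pow, Real.norm_eq_abs, sq_abs]
    ring
  have hid : ∀ x, ‖fderiv ℝ u x‖ ^ 2 =
      (2 * ‖x‖ ^ 2 * deriv F (‖x‖ ^ 2) + d * F (‖x‖ ^ 2)) + μ * u x ^ 2 +
        4 * ‖x‖ ^ 2 * (f (‖x‖ ^ 2) * deriv ξ (‖x‖ ^ 2)) ^ 2 := fun x => by
    rw [hgrad, dg, dF]
    simp only [hFdef, hu, hg]
    linear_combination (-(f (‖x‖ ^ 2)) * ξ (‖x‖ ^ 2) ^ 2) * ode (‖x‖ ^ 2)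
  have cF' : Continuous (deriv F) := hFs.continuous_deriv (by simp)
  have cF := hFs.continuous
  have cf := hf.continuous
  have hξ1 : ∀ s, 1 ≤ s → deriv ξ s = 0 := fun s hs => by
    have : ξ =ᶠ[nhds s] fun _ => 0 := by
      filter_upwards [Ioi_mem_nhds (hr.trans_le hs)] with y hy using hξr y (le_of_lt hy)
    simp [this.deriv_eq]
  have hint2 : Integrable fun x => μ * u x ^ 2 :=
    (Continuous.integrable_of_hasCompactSupport (by have := hus.continuous; fun_prop)
      (huc.comp_left (g := fun t => t ^ 2) (by simp))).const_mul μ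
  have hint3 : Integrable fun x : EuclideanSpace ℝ (Fin d) =>
      4 * ‖x‖ ^ 2 * (f (‖x‖ ^ 2) * deriv ξ (‖x‖ ^ 2)) ^ 2 := by
    refine Continuous.integrable_of_hasCompactSupport (by fun_prop)
      (hasCompactSupport_comp_norm_sq (F := fun s => 4 * s * (f s * deriv ξ s) ^ 2) fun s hs => ?_)
    simp [hξ1 s hs]
  have hint1 : Integrable fun x : EuclideanSpace ℝ (Fin d) =>
      2 * ‖x‖ ^ 2 * deriv F (‖x‖ ^ 2) + d * F (‖x‖ ^ 2) := by
    refine Continuous.integrable_of_hasCompactSupport (by fun_prop)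
      (hasCompactSupport_comp_norm_sq (F := fun s => 2 * s * deriv F s + d * F s) fun s hs => ?_)
    have : ξ s = 0 := hξr s (hr.le.trans hs)
    have hFs0 : F s = 0 := by simp [hFdef, this]
    simp only [dF, hFs0, this]
    ring
  have hF0 := integral_divergence_radial_eq_zero (d := d) (hFs.of_le (by simp))
    (fun s hs => by simp [hFdef, hξr s (hr.le.trans hs)])
  have hint12 : Integrable fun x : EuclideanSpace ℝ (Fin d) =>
      2 * ‖x‖ ^ 2 * deriv F (‖x‖ ^ 2) + d * F (‖x‖ ^ 2) + μ * u x ^ 2 := hint1.add hint2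
  rw [integral_congr_ae (Filter.Eventually.of_forall hid), integral_add hint12 hint3,
    integral_add hint1 hint2, hF0, integral_const_mul] at hmain
  have : ∫ x : EuclideanSpace ℝ (Fin d), (f (‖x‖ ^ 2) * ξ (‖x‖ ^ 2)) ^ 2 = ∫ x, u x ^ 2 := rfl
  rw [this]
  linarith

lemma radial_eigenfunction_ne_zero {d : ℕ} {μ : ℝ}
    (hμ : μ < rayleighQuotientInf (Metric.ball (0 : EuclideanSpace ℝ (Fin d)) 1))
    {f : ℝ → ℝ} (hf : ContDiff ℝ ∞ f) (f0 : f 0 = 1)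
    (ode : ∀ s, 4 * s * deriv (deriv f) s + 2 * d * deriv f s + μ * f s = 0)
    {r : ℝ} (hr0 : 0 < r) (hr1 : r ≤ 1) : f r ≠ 0 := by
  intro hfr
  let Θ : ℝ → ℝ := fun y => Real.smoothTransition (y - 1)
  have hΘ : ContDiff ℝ ∞ Θ :=
    Real.smoothTransition.contDiff.comp (contDiff_id.sub contDiff_const)
  have Θ0 : ∀ y, y ≤ 1 → Θ y = 0 := fun y hy =>
    Real.smoothTransition.zero_of_nonpos (by linarith)
  have Θ1 : ∀ y, 2 ≤ y → Θ y = 1 := fun y hy =>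
    Real.smoothTransition.one_of_one_le (by linarith)
  have Θle : ∀ y, |Θ y| ≤ 1 := fun y => by
    rw [abs_of_nonneg (Real.smoothTransition.nonneg _)]; exact Real.smoothTransition.le_one _
  have Θ0' : ∀ y, y < 1 → deriv Θ y = 0 := fun y hy => by
    have : Θ =ᶠ[nhds y] fun _ => 0 := by
      filter_upwards [Iio_mem_nhds hy] with z hz using Θ0 z (le_of_lt hz)
    simp [this.deriv_eq]
  have Θ1' : ∀ y, 2 < y → deriv Θ y = 0 := fun y hy => by
    have : Θ =ᶠ[nhds y] fun _ => 1 := by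
      filter_upwards [Ioi_mem_nhds hy] with z hz using Θ1 z (le_of_lt hz)
    simp [this.deriv_eq]
  have cΘ' : Continuous (deriv Θ) := hΘ.continuous_deriv (by simp)
  obtain ⟨M, hM⟩ : ∃ M, ∀ y ∈ Set.Icc (1 : ℝ) 2, ‖deriv Θ y‖ ≤ M :=
    isCompact_Icc.exists_bound_of_continuousOn cΘ'.continuousOn
  have df := hf.differentiable (by simp)
  have cf := hf.continuous
  obtain ⟨C, hC⟩ : ∃ C, ∀ y ∈ Set.Icc (0 : ℝ) 1, ‖deriv f y‖ ≤ C :=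
    isCompact_Icc.exists_bound_of_continuousOn (hf.continuous_deriv (by simp)).continuousOn
  obtain ⟨B, hB⟩ : ∃ B, ∀ y ∈ Set.Icc (0 : ℝ) 1, ‖f y‖ ≤ B :=
    isCompact_Icc.exists_bound_of_continuousOn cf.continuousOn
  have hM0 : 0 ≤ M := (norm_nonneg _).trans (hM 1 (by norm_num))
  have hC0 : 0 ≤ C := (norm_nonneg _).trans (hC 1 (by norm_num))
  have hB0 : 0 ≤ B := (norm_nonneg _).trans (hB 1 (by norm_num))
  have hlip : ∀ s ∈ Set.Icc (0 : ℝ) r, |f s| ≤ C * (r - s) := fun s hs => by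
    have h := (convex_Icc (0 : ℝ) 1).norm_image_sub_le_of_norm_deriv_le
      (fun y _ => df y) hC (Set.mem_Icc.2 ⟨hr0.le, hr1⟩) (Set.mem_Icc.2 ⟨hs.1, hs.2.trans hr1⟩)
    rw [hfr, sub_zero, Real.norm_eq_abs, Real.norm_eq_abs, abs_sub_comm,
      abs_of_nonneg (by linarith [hs.2] : 0 ≤ r - s)] at h
    exact h
  let ξ : ℕ → ℝ → ℝ := fun n s => Θ ((n + 1) * (r - s))
  have hξ : ∀ n, ContDiff ℝ ∞ (ξ n) := fun n =>
    hΘ.comp (contDiff_const.mul (contDiff_const.sub contDiff_id))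
  have hξ' : ∀ n s, deriv (ξ n) s = -((n + 1) * deriv Θ ((n + 1) * (r - s))) := fun n s => by
    have h1 : HasDerivAt (fun s : ℝ => ((n : ℝ) + 1) * (r - s)) (-(n + 1)) s := by
      simpa using ((hasDerivAt_id s).const_sub r).const_mul ((n : ℝ) + 1)
    have h2 := ((hΘ.differentiable (by simp) _).hasDerivAt.comp s h1).deriv
    refine Eq.trans h2 ?_
    ring
  have hbig : ∀ s < r, ∀ᶠ n : ℕ in Filter.atTop, 2 < ((n : ℝ) + 1) * (r - s) := fun s hs => by
    have h := (Filter.tendsto_atTop_add_const_right _ (1 : ℝ)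
      tendsto_natCast_atTop_atTop).atTop_mul_const (sub_pos.2 hs)
    exact h.eventually_gt_atTop 2
  have hneg : ∀ s, r ≤ s → ∀ n : ℕ, ((n : ℝ) + 1) * (r - s) ≤ 0 := fun s hs n =>
    mul_nonpos_of_nonneg_of_nonpos (by positivity) (by linarith)
  have hmain := fun n : ℕ => rayleighQuotientInf_sub_mul_integral_le (d := d) (r := r - 1 / (n + 1))
    hf ode (hξ n) (by have : (0 : ℝ) < 1 / (n + 1) := by positivity
                      linarith) (fun s hs => by
      refine Θ0 _ ?_
      have h : r - s ≤ 1 / (n + 1) := by linarith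
      calc ((n : ℝ) + 1) * (r - s) ≤ (n + 1) * (1 / (n + 1)) := by gcongr
        _ = 1 := by field_simp)
  let I : EuclideanSpace ℝ (Fin d) → ℝ :=
    (Metric.closedBall (0 : EuclideanSpace ℝ (Fin d)) 1).indicator fun _ => 1
  have hI : Integrable I := by
    refine (integrable_indicator_iff Metric.isClosed_closedBall.measurableSet).2 ?_
    exact integrableOn_const (isCompact_closedBall _ _).measure_lt_top.ne
  have hI1 : ∀ x : EuclideanSpace ℝ (Fin d), ‖x‖ ^ 2 ≤ r → I x = 1 := fun x hx => by
    refine Set.indicator_of_mem ?_ _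
    rw [mem_closedBall_zero_iff]
    nlinarith [norm_nonneg x]
  have hI0 : ∀ x, 0 ≤ I x := fun x => Set.indicator_nonneg (fun _ _ => zero_le_one) x
  let Φ : EuclideanSpace ℝ (Fin d) → ℝ :=
    fun x => if ‖x‖ ^ 2 < r then f (‖x‖ ^ 2) ^ 2 else 0
  have lim1 : Filter.Tendsto (fun n => ∫ x : EuclideanSpace ℝ (Fin d),
      (f (‖x‖ ^ 2) * ξ n (‖x‖ ^ 2)) ^ 2) Filter.atTop (nhds (∫ x, Φ x)) := by
    refine tendsto_integral_of_dominated_convergence (fun x => B ^ 2 * I x) (fun n => ?_)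
      (hI.const_mul _) (fun n => Filter.Eventually.of_forall fun x => ?_)
      (Filter.Eventually.of_forall fun x => ?_)
    · have := (hξ n).continuous
      exact Continuous.aestronglyMeasurable (by fun_prop)
    · rcases lt_or_ge (‖x‖ ^ 2) r with h | h
      · rw [hI1 x h.le, mul_one, Real.norm_eq_abs, abs_pow, abs_mul]
        have h1 := hB (‖x‖ ^ 2) ⟨by positivity, by linarith⟩
        rw [Real.norm_eq_abs] at h1
        have h2 : |ξ n (‖x‖ ^ 2)| ≤ 1 := Θle _
        gcongr
        calc |f (‖x‖ ^ 2)| * |ξ n (‖x‖ ^ 2)| ≤ B * 1 := by gcongr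
          _ = B := mul_one B
      · have : ξ n (‖x‖ ^ 2) = 0 := Θ0 _ ((hneg _ h n).trans zero_le_one)
        rw [this]
        simpa using mul_nonneg (sq_nonneg B) (hI0 x)
    · rcases lt_or_ge (‖x‖ ^ 2) r with h | h
      · refine tendsto_const_nhds.congr' ?_
        filter_upwards [hbig _ h] with n hn
        simp only [Φ, if_pos h, ξ, Θ1 _ hn.le, mul_one]
      · refine tendsto_const_nhds.congr fun n => ?_
        have : ξ n (‖x‖ ^ 2) = 0 := Θ0 _ ((hneg _ h n).trans zero_le_one)
        simp [Φ, not_lt.2 h, this]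
  have lim2 : Filter.Tendsto (fun n => ∫ x : EuclideanSpace ℝ (Fin d),
      4 * ‖x‖ ^ 2 * (f (‖x‖ ^ 2) * deriv (ξ n) (‖x‖ ^ 2)) ^ 2) Filter.atTop
      (nhds (∫ x : EuclideanSpace ℝ (Fin d), (0 : ℝ))) := by
    refine tendsto_integral_of_dominated_convergence (fun x => 4 * (C * (2 * M)) ^ 2 * I x)
      (fun n => ?_) (hI.const_mul _) (fun n => Filter.Eventually.of_forall fun x => ?_)
      (Filter.Eventually.of_forall fun x => ?_)
    · have := (hξ n).continuous_deriv (by simp)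
      exact Continuous.aestronglyMeasurable (by fun_prop)
    · by_cases h : 1 ≤ ((n : ℝ) + 1) * (r - ‖x‖ ^ 2) ∧ ((n : ℝ) + 1) * (r - ‖x‖ ^ 2) ≤ 2
      · have hxr : ‖x‖ ^ 2 ≤ r := by
          by_contra hc
          linarith [hneg _ (not_le.1 hc).le n]
        have h1 := hlip _ ⟨by positivity, hxr⟩
        have h2 := hM _ h
        rw [Real.norm_eq_abs] at h2
        rw [hI1 x hxr, mul_one, Real.norm_eq_abs, abs_mul, abs_pow, abs_mul (f _),
          abs_of_nonneg (by positivity), hξ', abs_neg, abs_mul,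
          abs_of_nonneg (by positivity : (0 : ℝ) ≤ n + 1)]
        have h3 : |f (‖x‖ ^ 2)| * ((n + 1) * |deriv Θ ((n + 1) * (r - ‖x‖ ^ 2))|) ≤
            C * (2 * M) := by
          calc _ ≤ (C * (r - ‖x‖ ^ 2)) * ((n + 1) * M) := by gcongr
            _ = C * (((n + 1) * (r - ‖x‖ ^ 2)) * M) := by ring
            _ ≤ C * (2 * M) := by gcongr; exact h.2
        have h4 : 4 * ‖x‖ ^ 2 ≤ 4 := by linarith
        gcongr
      · have : deriv (ξ n) (‖x‖ ^ 2) = 0 := by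
          rw [hξ']
          rcases lt_or_ge (((n : ℝ) + 1) * (r - ‖x‖ ^ 2)) 1 with h1 | h1
          · simp [Θ0' _ h1]
          · simp [Θ1' _ (not_le.1 fun h2 => h ⟨h1, h2⟩)]
        rw [this]
        simpa using mul_nonneg (by positivity : 0 ≤ 4 * (C * (2 * M)) ^ 2) (hI0 x)
    · rcases lt_or_ge (‖x‖ ^ 2) r with h | h
      · refine tendsto_const_nhds.congr' ?_
        filter_upwards [hbig _ h] with n hn
        simp [hξ', Θ1' _ hn]
      · refine tendsto_const_nhds.congr fun n => ?_
        simp [hξ', Θ0' _ ((hneg _ h n).trans_lt zero_lt_one)]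
  have hle := le_of_tendsto_of_tendsto' (lim1.const_mul _) lim2 hmain
  rw [integral_zero] at hle
  have hΦ0 : ∀ x, 0 ≤ Φ x := fun x => by
    simp only [Φ]; split_ifs <;> positivity
  have hΦi : Integrable Φ := by
    have hms : MeasurableSet {x : EuclideanSpace ℝ (Fin d) | ‖x‖ ^ 2 < r} :=
      (isOpen_lt (by fun_prop) continuous_const).measurableSet
    refine (hI.const_mul (B ^ 2)).mono' (Measurable.ite hms
      (Continuous.measurable (by fun_prop)) measurable_const).aestronglyMeasurable
      (Filter.Eventually.of_forall fun x => ?_)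
    simp only [Φ]
    split_ifs with h
    · rw [hI1 x h.le, mul_one, Real.norm_eq_abs, abs_pow]
      have h1 := hB (‖x‖ ^ 2) ⟨by positivity, by linarith⟩
      rw [Real.norm_eq_abs] at h1
      gcongr
    · simpa using mul_nonneg (sq_nonneg B) (hI0 x)
  have hpos : 0 < ∫ x, Φ x := by
    rw [integral_pos_iff_support_of_nonneg hΦ0 hΦi]
    have hopen : IsOpen {x : EuclideanSpace ℝ (Fin d) | ‖x‖ ^ 2 < r ∧ 0 < f (‖x‖ ^ 2)} :=
      IsOpen.and (isOpen_lt (by fun_prop) continuous_const)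
        (isOpen_lt continuous_const (by fun_prop))
    refine (hopen.measure_pos volume ⟨0, by simp [hr0, f0]⟩).trans_le
      (measure_mono fun x hx => ?_)
    simp [Φ, hx.1, hx.2.ne']
  nlinarith

lemma radial_eigenfunction_pos {d : ℕ} {μ : ℝ}
    (hμ : μ < rayleighQuotientInf (Metric.ball (0 : EuclideanSpace ℝ (Fin d)) 1))
    {f : ℝ → ℝ} (hf : ContDiff ℝ ∞ f) (f0 : f 0 = 1)
    (ode : ∀ s, 4 * s * deriv (deriv f) s + 2 * d * deriv f s + μ * f s = 0) :
    ∀ s ∈ Set.Icc (0 : ℝ) 1, 0 < f s := by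
  intro s hs
  by_contra! hneg
  obtain ⟨r, hr, hfr⟩ := intermediate_value_Icc' hs.1 hf.continuous.continuousOn
    ⟨hneg, f0.symm ▸ zero_le_one⟩
  refine radial_eigenfunction_ne_zero hμ hf f0 ode (hr.1.lt_of_ne ?_) (hr.2.trans hs.2) hfr
  rintro rfl
  simp [f0] at hfr

lemma iteratedFDeriv_two_apply_eq_deriv_deriv {E : Type*} [NormedAddCommGroup E]
    [NormedSpace ℝ E] {W : E → ℝ} (hW : ContDiff ℝ 2 W) (x e : E) :
    iteratedFDeriv ℝ 2 W x ![e, e] = deriv (deriv fun t : ℝ => W (x + t • e)) 0 := by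
  have hline : ∀ t : ℝ, HasDerivAt (fun t : ℝ => x + t • e) e t := fun t => by
    simpa using ((hasDerivAt_id t).smul_const e).const_add x
  have h1 : ∀ t : ℝ, deriv (fun t : ℝ => W (x + t • e)) t = fderiv ℝ W (x + t • e) e := fun t =>
    ((hW.differentiable (by simp) _).hasFDerivAt.comp_hasDerivAt t (hline t)).deriv
  have hW' : Differentiable ℝ (fderiv ℝ W) :=
    (hW.fderiv_right (m := 1) (by norm_num)).differentiable (by simp)
  have hd : HasFDerivAt (fderiv ℝ W) (fderiv ℝ (fderiv ℝ W) x) (x + (0 : ℝ) • e) := by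
    simpa using (hW' x).hasFDerivAt
  have hc : HasDerivAt (fun t : ℝ => fderiv ℝ W (x + t • e)) (fderiv ℝ (fderiv ℝ W) x e) 0 :=
    hd.comp_hasDerivAt (0 : ℝ) (hline 0)
  have h2 : HasDerivAt (fun t : ℝ => fderiv ℝ W (x + t • e) e)
      (fderiv ℝ (fderiv ℝ W) x e e) 0 := by
    simpa using hc.clm_apply (hasDerivAt_const (0 : ℝ) e)
  rw [funext h1, iteratedFDeriv_two_apply, h2.deriv]
  simp

lemma deriv_deriv_mul_comp_quadratic {f k : ℝ → ℝ} (hf : ContDiff ℝ 2 f) (hk : ContDiff ℝ 2 k)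
    (p b l q c g : ℝ) :
    deriv (deriv fun t : ℝ => f (q + 2 * c * t + g * t ^ 2) * k (p + 2 * b * t + l * t ^ 2)) 0 =
      (4 * c ^ 2 * deriv (deriv f) q + 2 * g * deriv f q) * k p +
        8 * (b * c) * (deriv f q * deriv k p) +
        f q * (4 * b ^ 2 * deriv (deriv k) p + 2 * l * deriv k p) := by
  have hq : ∀ (q c g t : ℝ), HasDerivAt (fun t : ℝ => q + 2 * c * t + g * t ^ 2)
      (2 * c + 2 * g * t) t := fun q c g t => by
    have := (((hasDerivAt_id t).const_mul (2 * c)).const_add q).add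
      (((hasDerivAt_id t).pow 2).const_mul g)
    refine this.congr_deriv ?_
    simp; ring
  have hl : ∀ (c g : ℝ), HasDerivAt (fun t : ℝ => 2 * c + 2 * g * t) (2 * g) 0 := fun c g => by
    simpa using ((hasDerivAt_id (0 : ℝ)).const_mul (2 * g)).const_add (2 * c)
  have df := hf.differentiable (by simp)
  have dk := hk.differentiable (by simp)
  have df' : Differentiable ℝ (deriv f) :=
    (ContDiff.deriv' (n := 1) hf).differentiable (by simp)
  have dk' : Differentiable ℝ (deriv k) :=
    (ContDiff.deriv' (n := 1) hk).differentiable (by simp)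
  have hF : ∀ t, HasDerivAt (fun t : ℝ => f (q + 2 * c * t + g * t ^ 2))
      (deriv f (q + 2 * c * t + g * t ^ 2) * (2 * c + 2 * g * t)) t := fun t =>
    (df _).hasDerivAt.comp t (hq q c g t)
  have hK : ∀ t, HasDerivAt (fun t : ℝ => k (p + 2 * b * t + l * t ^ 2))
      (deriv k (p + 2 * b * t + l * t ^ 2) * (2 * b + 2 * l * t)) t := fun t =>
    (dk _).hasDerivAt.comp t (hq p b l t)
  have hF' := ((df' _).hasDerivAt.comp (0 : ℝ) (hq q c g 0)).mul (hl c g)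
  have hK' := ((dk' _).hasDerivAt.comp (0 : ℝ) (hq p b l 0)).mul (hl b l)
  have hFK : ∀ t, deriv (fun t : ℝ => f (q + 2 * c * t + g * t ^ 2) *
      k (p + 2 * b * t + l * t ^ 2)) t = _ := fun t => ((hF t).mul (hK t)).deriv
  rw [funext hFK]
  refine ((hF'.mul (hK 0)).add ((hF 0).mul hK')).deriv.trans ?_
  simp
  ring

/-- The Laplacian of a function of the distances to a point and to a line through that point. -/
lemma laplacian_mul_comp {N : ℕ} {f k : ℝ → ℝ} (hf : ContDiff ℝ 2 f) (hk : ContDiff ℝ 2 k)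
    (a τ : EuclideanSpace ℝ (Fin N)) (hτ : ‖τ‖ = 1) (x : EuclideanSpace ℝ (Fin N)) {p q : ℝ}
    (hp : p = ‖x - a‖ ^ 2) (hq : q = ‖x - a‖ ^ 2 - ⟪x - a, τ⟫ ^ 2) :
    laplacian (fun x => f (‖x - a‖ ^ 2 - ⟪x - a, τ⟫ ^ 2) * k (‖x - a‖ ^ 2)) x =
      (4 * q * deriv (deriv f) q + 2 * (N - 1) * deriv f q) * k p +
        8 * q * (deriv f q * deriv k p) +
        f q * (4 * p * deriv (deriv k) p + 2 * N * deriv k p) := by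
  have hT : ContDiff ℝ 2 fun x : EuclideanSpace ℝ (Fin N) =>
      f (‖x - a‖ ^ 2 - ⟪x - a, τ⟫ ^ 2) * k (‖x - a‖ ^ 2) := by
    have h1 : ContDiff ℝ 2 fun x : EuclideanSpace ℝ (Fin N) => ‖x - a‖ ^ 2 :=
      (contDiff_id.sub contDiff_const).norm_sq ℝ
    have h2 : ContDiff ℝ 2 fun x : EuclideanSpace ℝ (Fin N) => ⟪x - a, τ⟫ :=
      (contDiff_id.sub contDiff_const).inner ℝ contDiff_const
    exact (hf.comp (h1.sub (h2.pow 2))).mul (hk.comp h1)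
  set z := x - a with hz
  set m := ⟪z, τ⟫ with hm
  have hterm : ∀ i : Fin N, iteratedFDeriv ℝ 2 (fun x : EuclideanSpace ℝ (Fin N) =>
      f (‖x - a‖ ^ 2 - ⟪x - a, τ⟫ ^ 2) * k (‖x - a‖ ^ 2)) x
        ![EuclideanSpace.single i (1 : ℝ), EuclideanSpace.single i (1 : ℝ)] =
      (4 * (z i - m * τ i) ^ 2 * deriv (deriv f) q + 2 * (1 - τ i ^ 2) * deriv f q) * k p +
        8 * (z i * (z i - m * τ i)) * (deriv f q * deriv k p) +
        f q * (4 * z i ^ 2 * deriv (deriv k) p + 2 * 1 * deriv k p) := fun i => by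
    rw [iteratedFDeriv_two_apply_eq_deriv_deriv hT,
      ← deriv_deriv_mul_comp_quadratic hf hk p (z i) 1 q (z i - m * τ i) (1 - τ i ^ 2)]
    congr 2
    funext t
    have e1 : x + t • EuclideanSpace.single i (1 : ℝ) - a =
        z + t • EuclideanSpace.single i (1 : ℝ) := by rw [hz]; abel
    have e2 : ‖z + t • EuclideanSpace.single i (1 : ℝ)‖ ^ 2 = p + 2 * z i * t + 1 * t ^ 2 := by
      rw [norm_add_sq_real, inner_smul_right, EuclideanSpace.inner_single_right, norm_smul,
        hp]
      simp
      ring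
    have e3 : ⟪z + t • EuclideanSpace.single i (1 : ℝ), τ⟫ = m + t * τ i := by
      rw [inner_add_left, inner_smul_left, EuclideanSpace.inner_single_left]
      simp [hm]
    rw [e1, e2, e3]
    congr 2
    rw [hq, hp]
    ring
  have s1 : ∑ i, z i ^ 2 = p := by rw [hp, EuclideanSpace.real_norm_sq_eq]
  have s2 : ∑ i, τ i ^ 2 = 1 := by rw [← EuclideanSpace.real_norm_sq_eq, hτ, one_pow]
  have s3 : ∑ i, z i * τ i = m := by
    rw [hm, PiLp.inner_apply]
    exact Finset.sum_congr rfl fun i _ => by simp [mul_comm]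
  have s4 : ∑ i, (z i - m * τ i) ^ 2 = q := by
    have : ∀ i, (z i - m * τ i) ^ 2 = z i ^ 2 - 2 * m * (z i * τ i) + m ^ 2 * τ i ^ 2 :=
      fun i => by ring
    simp_rw [this, Finset.sum_add_distrib, Finset.sum_sub_distrib, ← Finset.mul_sum, s1, s2, s3,
      hq, hp]
    ring
  have s5 : ∑ i, z i * (z i - m * τ i) = q := by
    have : ∀ i, z i * (z i - m * τ i) = z i ^ 2 - m * (z i * τ i) := fun i => by ring
    simp_rw [this, Finset.sum_sub_distrib, ← Finset.mul_sum, s1, s3, hq, hp]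
    ring
  have s6 : ∑ i, (1 - τ i ^ 2) = (N : ℝ) - 1 := by
    rw [Finset.sum_sub_distrib, s2]; simp
  unfold laplacian
  simp_rw [hterm]
  simp only [Finset.sum_add_distrib, ← Finset.sum_mul, ← Finset.mul_sum, s1, s4, s5, s6]
  simp only [Finset.sum_const, Finset.card_univ, Fintype.card_fin, nsmul_eq_mul]
  ring

lemma laplacian_sum {N : ℕ} {ι : Type*} (s : Finset ι) {T : ι → EuclideanSpace ℝ (Fin N) → ℝ}
    (hT : ∀ i ∈ s, ContDiff ℝ 2 (T i)) (x : EuclideanSpace ℝ (Fin N)) :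
    laplacian (fun x => ∑ i ∈ s, T i x) x = ∑ i ∈ s, laplacian (T i) x := by
  unfold laplacian
  rw [Finset.sum_comm]
  refine Finset.sum_congr rfl fun j _ => ?_
  rw [iteratedFDeriv_fun_sum_apply (n := 2) (fun i hi => (hT i hi).contDiffAt)]
  simp

/-- Cutoff functions of `s = ‖x‖²` at scale `L`, with derivatives of size `L⁻²`. -/
lemma exists_scaled_cutoff : ∃ H : ℝ, 0 ≤ H ∧ ∀ L : ℝ, 0 < L → ∃ k : ℝ → ℝ,
    ContDiff ℝ 2 k ∧ (∀ s, 0 ≤ k s) ∧ (∀ s, s ≤ L ^ 2 / 2 → k s = 1) ∧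
    (∀ s, L ^ 2 < s → k s = 0 ∧ deriv k s = 0 ∧ deriv (deriv k) s = 0) ∧
    ∀ s, 0 ≤ s → s ≤ L ^ 2 → |deriv k s| ≤ H / L ^ 2 ∧ s * |deriv (deriv k) s| ≤ H / L ^ 2 := by
  let h : ℝ → ℝ := fun s => Real.smoothTransition (2 * (1 - s))
  have hh : ContDiff ℝ 2 h :=
    Real.smoothTransition.contDiff.comp (contDiff_const.mul (contDiff_const.sub contDiff_id))
  have hh' : ContDiff ℝ 1 (deriv h) := ContDiff.deriv' (n := 1) hh
  obtain ⟨H₁, hH₁⟩ : ∃ M, ∀ y ∈ Set.Icc (0 : ℝ) 1, ‖deriv h y‖ ≤ M :=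
    isCompact_Icc.exists_bound_of_continuousOn hh'.continuous.continuousOn
  obtain ⟨H₂, hH₂⟩ : ∃ M, ∀ y ∈ Set.Icc (0 : ℝ) 1, ‖deriv (deriv h) y‖ ≤ M :=
    isCompact_Icc.exists_bound_of_continuousOn (hh'.continuous_deriv le_rfl).continuousOn
  have hH0 : 0 ≤ max H₁ H₂ := ((norm_nonneg _).trans (hH₁ 0 (by norm_num))).trans (le_max_left _ _)
  refine ⟨max H₁ H₂, hH0, fun L hL => ?_⟩
  have hL2 : 0 < L ^ 2 := by positivity
  let k : ℝ → ℝ := fun s => h (s * (L ^ 2)⁻¹)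
  have hk' : ∀ s, deriv k s = deriv h (s * (L ^ 2)⁻¹) * (L ^ 2)⁻¹ := fun s => by
    refine ((hh.differentiable (by simp) _).hasDerivAt.comp s
      ((hasDerivAt_id s).mul_const (L ^ 2)⁻¹)).deriv.trans ?_
    simp
  have hk'' : ∀ s, deriv (deriv k) s = deriv (deriv h) (s * (L ^ 2)⁻¹) * (L ^ 2)⁻¹ * (L ^ 2)⁻¹ :=
    fun s => by
      rw [funext hk']
      refine (((hh'.differentiable (by simp) _).hasDerivAt.comp s
        ((hasDerivAt_id s).mul_const (L ^ 2)⁻¹)).mul_const _).deriv.trans ?_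
      simp
  have hzero : ∀ s, L ^ 2 < s → k s = 0 := fun s hs => by
    refine Real.smoothTransition.zero_of_nonpos ?_
    have : 1 ≤ s * (L ^ 2)⁻¹ := by rw [← div_eq_mul_inv, one_le_div hL2]; exact hs.le
    linarith
  have hzero' : ∀ s, L ^ 2 < s → deriv k s = 0 := fun s hs => by
    have : k =ᶠ[nhds s] fun _ => 0 := by
      filter_upwards [Ioi_mem_nhds hs] with y hy using hzero y hy
    simp [this.deriv_eq]
  refine ⟨k, hh.comp (contDiff_id.mul contDiff_const),
    fun s => Real.smoothTransition.nonneg _, fun s hs => ?_,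
    fun s hs => ⟨hzero s hs, hzero' s hs, ?_⟩, fun s hs0 hs => ?_⟩
  · refine Real.smoothTransition.one_of_one_le ?_
    have : s * (L ^ 2)⁻¹ ≤ 1 / 2 := by
      rw [← div_eq_mul_inv, div_le_iff₀ hL2]; linarith
    linarith
  · have : deriv k =ᶠ[nhds s] fun _ => 0 := by
      filter_upwards [Ioi_mem_nhds hs] with y hy using hzero' y hy
    simp [this.deriv_eq]
  · have hs1 : s * (L ^ 2)⁻¹ ≤ 1 := by rw [← div_eq_mul_inv, div_le_one hL2]; exact hs
    have hs2 : 0 ≤ s * (L ^ 2)⁻¹ := by positivity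
    have b1 := (hH₁ _ ⟨hs2, hs1⟩).trans (le_max_left H₁ H₂)
    have b2 := (hH₂ _ ⟨hs2, hs1⟩).trans (le_max_right H₁ H₂)
    rw [Real.norm_eq_abs] at b1 b2
    have hi : 0 < (L ^ 2)⁻¹ := by positivity
    rw [hk', hk'', abs_mul, abs_mul, abs_mul, abs_of_pos hi, div_eq_mul_inv]
    refine ⟨by gcongr, ?_⟩
    calc s * (|deriv (deriv h) (s * (L ^ 2)⁻¹)| * (L ^ 2)⁻¹ * (L ^ 2)⁻¹)
        = (s * (L ^ 2)⁻¹) * (|deriv (deriv h) (s * (L ^ 2)⁻¹)| * (L ^ 2)⁻¹) := by ring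
      _ ≤ 1 * (max H₁ H₂ * (L ^ 2)⁻¹) := by gcongr
      _ = _ := one_mul _

lemma exists_norm_lower_bound {E : Type*} [NormedAddCommGroup E] {g : ℝ → E}
    (hg : ContinuousOn g (Set.Icc 0 1))
    (hg0 : ∀ t ∈ Set.Icc (0 : ℝ) 1, g t ≠ 0) :
    ∃ m > 0, ∀ t ∈ Set.Icc (0 : ℝ) 1, m ≤ ‖g t‖ :=
  isCompact_Icc.exists_forall_le' hg.norm fun t ht => norm_pos_iff.2 (hg0 t ht)

section Curve

variable {E : Type*} [NormedAddCommGroup E] [NormedSpace ℝ E] {γ g : ℝ → E}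

lemma exists_uniform_linear_approx (hg : ContinuousOn g (Set.Icc 0 1))
    (hd : ∀ t ∈ Set.Icc (0 : ℝ) 1, HasDerivWithinAt γ (g t) (Set.Icc 0 1) t)
    {η : ℝ} (hη : 0 < η) :
    ∃ δ > 0, ∀ s ∈ Set.Icc (0 : ℝ) 1, ∀ t ∈ Set.Icc (0 : ℝ) 1, |s - t| ≤ δ →
      ‖γ s - γ t - (s - t) • g t‖ ≤ η * |s - t| ∧ ‖g s - g t‖ ≤ η := by
  obtain ⟨δ, hδ, h⟩ := Metric.uniformContinuousOn_iff.1
    (isCompact_Icc.uniformContinuousOn_of_continuous hg) η hη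
  have hclose : ∀ s ∈ Set.Icc (0 : ℝ) 1, ∀ t ∈ Set.Icc (0 : ℝ) 1, |s - t| ≤ δ / 2 →
      ‖g s - g t‖ ≤ η := fun s hs t ht hst => by
    rw [← dist_eq_norm]
    exact (h s hs t ht (by rw [Real.dist_eq]; linarith)).le
  refine ⟨δ / 2, by positivity, fun s hs t ht hst => ⟨?_, hclose s hs t ht hst⟩⟩
  have hsub : Set.uIcc t s ⊆ Set.Icc 0 1 := Set.uIcc_subset_Icc ht hs
  have key := (convex_uIcc t s).norm_image_sub_le_of_norm_hasDerivWithin_le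
    (f := fun x => γ x - x • g t) (f' := fun x => g x - g t) (C := η)
    (fun x hx => ((hd x (hsub hx)).mono hsub).sub
      (by simpa using (hasDerivWithinAt_id x _).smul_const (g t)))
    (fun x hx => hclose x (hsub hx) t ht
      ((Set.abs_sub_left_of_mem_uIcc hx).trans hst))
    Set.left_mem_uIcc Set.right_mem_uIcc
  rw [Real.norm_eq_abs] at key
  refine le_trans (le_of_eq ?_) key
  congr 1
  rw [sub_smul]
  abel

lemma exists_lipschitz_bound (hg : ContinuousOn g (Set.Icc 0 1))
    (hd : ∀ t ∈ Set.Icc (0 : ℝ) 1, HasDerivWithinAt γ (g t) (Set.Icc 0 1) t) :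
    ∃ Λ > 0, ∀ s ∈ Set.Icc (0 : ℝ) 1, ∀ t ∈ Set.Icc (0 : ℝ) 1, ‖γ s - γ t‖ ≤ Λ * |s - t| := by
  obtain ⟨M, hM⟩ := isCompact_Icc.exists_bound_of_continuousOn hg
  refine ⟨max M 1, by positivity, fun s hs t ht => ?_⟩
  rw [← Real.norm_eq_abs]
  exact (convex_Icc (0 : ℝ) 1).norm_image_sub_le_of_norm_hasDerivWithin_le hd
    (fun x hx => (hM x hx).trans (le_max_left _ _)) ht hs

/-- Points of the curve that are close in space are related by an almost tangential step. -/
lemma exists_tangential_approx (hg : ContinuousOn g (Set.Icc 0 1))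
    (hd : ∀ t ∈ Set.Icc (0 : ℝ) 1, HasDerivWithinAt γ (g t) (Set.Icc 0 1) t)
    (hinj : ∀ s ∈ Set.Icc (0 : ℝ) 1, ∀ t ∈ Set.Icc (0 : ℝ) 1, γ s = γ t →
      s = t ∨ (s = 0 ∧ t = 1) ∨ (s = 1 ∧ t = 0))
    (hper : γ 0 = γ 1 → g 0 = g 1) {η : ℝ} (hη : 0 < η) :
    ∃ ρ > 0, ∀ s ∈ Set.Icc (0 : ℝ) 1, ∀ t ∈ Set.Icc (0 : ℝ) 1, ‖γ s - γ t‖ < ρ →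
      ∃ a : ℝ, ‖γ s - γ t - a • g t‖ ≤ η * |a| := by
  obtain ⟨δ, hδ, h⟩ := exists_uniform_linear_approx hg hd (half_pos hη)
  have hγc : ContinuousOn γ (Set.Icc 0 1) := fun t ht => (hd t ht).continuousWithinAt
  let K : Set (ℝ × ℝ) := (Set.Icc 0 1 ×ˢ Set.Icc 0 1) ∩
    {p | δ ≤ |p.1 - p.2| ∧ (γ 0 = γ 1 → |p.1 - p.2| ≤ 1 - δ)}
  have hK : IsCompact K := by
    refine (isCompact_Icc.prod isCompact_Icc).inter_right ?_
    have hc : Continuous fun p : ℝ × ℝ => |p.1 - p.2| := by fun_prop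
    by_cases h01 : γ 0 = γ 1
    · simp only [h01, true_imp_iff]
      exact (isClosed_le continuous_const hc).inter (isClosed_le hc continuous_const)
    · simpa [h01] using isClosed_le continuous_const hc
  have hcont : ContinuousOn (fun p : ℝ × ℝ => ‖γ p.1 - γ p.2‖) K :=
    ((hγc.comp continuousOn_fst fun p hp => hp.1.1).sub
      (hγc.comp continuousOn_snd fun p hp => hp.1.2)).norm
  obtain ⟨ρ, hρ, hmin⟩ := hK.exists_forall_le' hcont (a := 0) (by
    rintro ⟨s, t⟩ ⟨⟨hs, ht⟩, hst, hst'⟩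
    refine norm_pos_iff.2 (sub_ne_zero.2 fun he => ?_)
    rcases hinj s hs t ht he with e | ⟨e₁, e₂⟩ | ⟨e₁, e₂⟩
    · simp only [e, sub_self, abs_zero] at hst
      linarith
    · have := hst' (by rw [← e₁, ← e₂, he])
      simp only [e₁, e₂] at this
      norm_num at this
      linarith
    · have := hst' (by rw [← e₁, ← e₂, he])
      simp only [e₁, e₂] at this
      norm_num at this
      linarith)
  refine ⟨ρ, hρ, fun s hs t ht hst => ?_⟩
  have hnot : (s, t) ∉ K := fun hmem => (hmin _ hmem).not_gt hst
  by_cases hnear : |s - t| ≤ δ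
  · exact ⟨s - t, (h s hs t ht hnear).1.trans (by gcongr; linarith)⟩
  have hclosed : γ 0 = γ 1 ∧ 1 - δ < |s - t| := by
    by_contra hcon
    refine hnot ⟨⟨hs, ht⟩, (not_le.1 hnear).le, fun h01 => ?_⟩
    by_contra hlt
    exact hcon ⟨h01, not_le.1 hlt⟩
  obtain ⟨h01, hfar⟩ := hclosed
  have hg01 := hper h01
  have z0 : (0 : ℝ) ∈ Set.Icc (0 : ℝ) 1 := by norm_num
  have z1 : (1 : ℝ) ∈ Set.Icc (0 : ℝ) 1 := by norm_num
  obtain ⟨s0, s1⟩ := hs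
  obtain ⟨t0, t1⟩ := ht
  have hjoin : ∀ e₀ ∈ Set.Icc (0 : ℝ) 1, ∀ e₁ ∈ Set.Icc (0 : ℝ) 1, γ e₀ = γ e₁ → g e₀ = g e₁ →
      |s - e₀| ≤ δ → |t - e₁| ≤ δ → |s - e₀| + |t - e₁| = |s - e₀ + (e₁ - t)| →
      ‖γ s - γ t - (s - e₀ + (e₁ - t)) • g t‖ ≤ η * |s - e₀ + (e₁ - t)| := by
    intro e₀ h₀ e₁ h₁ hγe hge hs' ht' hsum
    obtain ⟨b₁, -⟩ := h s ⟨s0, s1⟩ e₀ h₀ hs'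
    obtain ⟨b₂, -⟩ := h e₁ h₁ t ⟨t0, t1⟩ (by rwa [abs_sub_comm])
    obtain ⟨-, b₃⟩ := h t ⟨t0, t1⟩ e₁ h₁ ht'
    rw [abs_sub_comm e₁ t] at b₂
    have hsplit : γ s - γ t - (s - e₀ + (e₁ - t)) • g t =
        (γ s - γ e₀ - (s - e₀) • g e₀) + (γ e₁ - γ t - (e₁ - t) • g t) -
          (s - e₀) • (g t - g e₁) := by
      rw [hγe, hge, add_smul, smul_sub]
      abel
    have b₄ : ‖(s - e₀) • (g t - g e₁)‖ ≤ |s - e₀| * (η / 2) := by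
      rw [norm_smul, Real.norm_eq_abs]
      gcongr
    rw [hsplit, ← hsum]
    have := norm_sub_le ((γ s - γ e₀ - (s - e₀) • g e₀) + (γ e₁ - γ t - (e₁ - t) • g t))
      ((s - e₀) • (g t - g e₁))
    have := norm_add_le (γ s - γ e₀ - (s - e₀) • g e₀) (γ e₁ - γ t - (e₁ - t) • g t)
    have : 0 ≤ η * |t - e₁| := by positivity
    nlinarith
  rcases le_total s t with hle | hle
  · rw [abs_of_nonpos (by linarith)] at hfar
    refine ⟨_, hjoin 0 z0 1 z1 h01 hg01 ?_ ?_ ?_⟩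
    · rw [abs_of_nonneg] <;> linarith
    · rw [abs_of_nonpos] <;> linarith
    · rw [abs_of_nonneg (by linarith : 0 ≤ s - 0), abs_of_nonpos (by linarith : t - 1 ≤ 0),
        abs_of_nonneg (by linarith)]
      ring
  · rw [abs_of_nonneg (by linarith)] at hfar
    refine ⟨_, hjoin 1 z1 0 z0 h01.symm hg01.symm ?_ ?_ ?_⟩
    · rw [abs_of_nonpos] <;> linarith
    · rw [abs_of_nonneg] <;> linarith
    · rw [abs_of_nonpos (by linarith : s - 1 ≤ 0), abs_of_nonneg (by linarith : 0 ≤ t - 0),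
        abs_of_nonpos (by linarith)]
      ring

lemma exists_injectivity_bound (hg : ContinuousOn g (Set.Icc 0 1))
    (hd : ∀ t ∈ Set.Icc (0 : ℝ) 1, HasDerivWithinAt γ (g t) (Set.Icc 0 1) t)
    (hg0 : ∀ t ∈ Set.Icc (0 : ℝ) 1, g t ≠ 0)
    (hinj : ∀ s ∈ Set.Icc (0 : ℝ) 1, ∀ t ∈ Set.Icc (0 : ℝ) 1, γ s = γ t →
      s = t ∨ (s = 0 ∧ t = 1) ∨ (s = 1 ∧ t = 0)) :
    ∃ c > 0, ∀ s ∈ Set.Icc (0 : ℝ) 1, ∀ t ∈ Set.Icc (0 : ℝ) 1, |s - t| ≤ 1 / 2 →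
      c * |s - t| ≤ ‖γ s - γ t‖ := by
  obtain ⟨m, hm, hgm⟩ := exists_norm_lower_bound hg hg0
  obtain ⟨δ, hδ, h⟩ := exists_uniform_linear_approx hg hd (half_pos hm)
  have hγc : ContinuousOn γ (Set.Icc 0 1) := fun t ht => (hd t ht).continuousWithinAt
  let K : Set (ℝ × ℝ) := (Set.Icc 0 1 ×ˢ Set.Icc 0 1) ∩
    {p | δ ≤ |p.1 - p.2| ∧ |p.1 - p.2| ≤ 1 / 2}
  have hc : Continuous fun p : ℝ × ℝ => |p.1 - p.2| := by fun_prop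
  have hK : IsCompact K := (isCompact_Icc.prod isCompact_Icc).inter_right
    ((isClosed_le continuous_const hc).inter (isClosed_le hc continuous_const))
  have hcont : ContinuousOn (fun p : ℝ × ℝ => ‖γ p.1 - γ p.2‖) K :=
    ((hγc.comp continuousOn_fst fun p hp => hp.1.1).sub
      (hγc.comp continuousOn_snd fun p hp => hp.1.2)).norm
  obtain ⟨ρ, hρ, hmin⟩ := hK.exists_forall_le' hcont (a := 0) (by
    rintro ⟨s, t⟩ ⟨⟨hs, ht⟩, hst, hst'⟩
    refine norm_pos_iff.2 (sub_ne_zero.2 fun he => ?_)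
    simp only at hst hst'
    rcases hinj s hs t ht he with e | ⟨e₁, e₂⟩ | ⟨e₁, e₂⟩
    · simp only [e, sub_self, abs_zero] at hst
      linarith
    · rw [e₁, e₂] at hst'
      norm_num at hst'
    · rw [e₁, e₂] at hst'
      norm_num at hst')
  refine ⟨min (m / 2) ρ, by positivity, fun s hs t ht hst => ?_⟩
  by_cases hnear : |s - t| ≤ δ
  · have h1 := (h s hs t ht hnear).1
    have h2 : ‖(s - t) • g t‖ ≤ ‖γ s - γ t‖ + ‖γ s - γ t - (s - t) • g t‖ := by
      have := norm_sub_le (γ s - γ t) (γ s - γ t - (s - t) • g t)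
      rwa [sub_sub_cancel] at this
    rw [norm_smul, Real.norm_eq_abs] at h2
    have h3 : |s - t| * m ≤ |s - t| * ‖g t‖ := by gcongr; exact hgm t ht
    have h4 : min (m / 2) ρ * |s - t| ≤ m / 2 * |s - t| := by gcongr; exact min_le_left _ _
    linarith
  · have h1 : ρ ≤ ‖γ s - γ t‖ := hmin (s, t) ⟨⟨hs, ht⟩, (not_le.1 hnear).le, hst⟩
    calc min (m / 2) ρ * |s - t| ≤ ρ * 1 := by
          gcongr
          · exact min_le_right _ _
          · linarith
      _ ≤ _ := by linarith

end Curve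

lemma norm_sq_sub_inner_sq_le {E : Type*} [NormedAddCommGroup E] [InnerProductSpace ℝ E]
    {τ : E} (hτ : ‖τ‖ = 1) (z : E) (c : ℝ) : ‖z‖ ^ 2 - ⟪z, τ⟫ ^ 2 ≤ ‖z - c • τ‖ ^ 2 := by
  rw [norm_sub_sq_real, inner_smul_right, norm_smul, hτ, Real.norm_eq_abs, mul_one, sq_abs]
  nlinarith [sq_nonneg (⟪z, τ⟫ - c)]

/-- The squared distance to tangent lines of `R • γ` nearby is almost at most `1` inside the
tubular neighborhood. -/
lemma exists_dist_tangent_line_le {E : Type*} [NormedAddCommGroup E] [InnerProductSpace ℝ E]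
    {γ g : ℝ → E} (hg : ContinuousOn g (Set.Icc 0 1))
    (hd : ∀ t ∈ Set.Icc (0 : ℝ) 1, HasDerivWithinAt γ (g t) (Set.Icc 0 1) t)
    (hg0 : ∀ t ∈ Set.Icc (0 : ℝ) 1, g t ≠ 0)
    (hinj : ∀ s ∈ Set.Icc (0 : ℝ) 1, ∀ t ∈ Set.Icc (0 : ℝ) 1, γ s = γ t →
      s = t ∨ (s = 0 ∧ t = 1) ∨ (s = 1 ∧ t = 0))
    (hper : γ 0 = γ 1 → g 0 = g 1) {L ε : ℝ} (hL : 0 < L) (hε : 0 < ε) :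
    ∃ R₀ > (0 : ℝ), ∀ R ≥ R₀, ∀ s ∈ Set.Icc (0 : ℝ) 1, ∀ t ∈ Set.Icc (0 : ℝ) 1, ∀ v : E, ‖v‖ < 1 →
      ‖R • γ s + v - R • γ t‖ ≤ L →
      ‖R • γ s + v - R • γ t‖ ^ 2 - ⟪R • γ s + v - R • γ t, ‖g t‖⁻¹ • g t⟫ ^ 2 ≤
        (1 + ε) ^ 2 := by
  obtain ⟨m, hm, hgm⟩ := exists_norm_lower_bound hg hg0
  let η : ℝ := min (m / 2) (ε * m / (2 * (L + 1)))
  have hη : 0 < η := by positivity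
  have hη1 : η ≤ m / 2 := min_le_left _ _
  have hη2 : η * (2 * (L + 1)) ≤ ε * m := by
    rw [← le_div_iff₀ (by positivity)]; exact min_le_right _ _
  obtain ⟨ρ, hρ, h⟩ := exists_tangential_approx hg hd hinj hper hη
  refine ⟨(L + 2) / ρ, by positivity, fun R hR s hs t ht v hv hle => ?_⟩
  have hR0 : 0 < R := lt_of_lt_of_le (by positivity) hR
  have hRρ : L + 2 ≤ R * ρ := by rwa [← div_le_iff₀ hρ]
  have hw : ‖R • (γ s - γ t)‖ ≤ L + 1 := by
    have e : R • (γ s - γ t) = (R • γ s + v - R • γ t) - v := by rw [smul_sub]; abel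
    rw [e]
    exact (norm_sub_le _ _).trans (by linarith)
  rw [norm_smul, Real.norm_of_nonneg hR0.le] at hw
  obtain ⟨a, ha⟩ := h s hs t ht (by
    have : R * ‖γ s - γ t‖ < R * ρ := by linarith
    exact lt_of_mul_lt_mul_left this hR0.le)
  have hgt : 0 < ‖g t‖ := hm.trans_le (hgm t ht)
  have hτ : ‖‖g t‖⁻¹ • g t‖ = 1 := by
    rw [norm_smul, norm_inv, norm_norm, inv_mul_cancel₀ hgt.ne']
  refine (norm_sq_sub_inner_sq_le hτ _ (R * a * ‖g t‖)).trans ?_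
  have e : R • γ s + v - R • γ t - (R * a * ‖g t‖) • ‖g t‖⁻¹ • g t =
      v + R • (γ s - γ t - a • g t) := by
    rw [smul_smul, mul_assoc (R * a), mul_inv_cancel₀ hgt.ne', mul_one, smul_sub, smul_sub,
      smul_smul]
    abel
  rw [e]
  have hag : |a| * m ≤ ‖γ s - γ t‖ + η * |a| := by
    have := norm_sub_le (γ s - γ t) (γ s - γ t - a • g t)
    rw [sub_sub_cancel, norm_smul, Real.norm_eq_abs] at this
    have : |a| * m ≤ |a| * ‖g t‖ := by gcongr; exact hgm t ht
    linarith
  have hRa : R * |a| * (m / 2) ≤ L + 1 := by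
    have h1 : |a| * (m / 2) ≤ ‖γ s - γ t‖ := by
      have : η * |a| ≤ m / 2 * |a| := by gcongr
      linarith
    calc R * |a| * (m / 2) = R * (|a| * (m / 2)) := by ring
      _ ≤ R * ‖γ s - γ t‖ := by gcongr
      _ ≤ L + 1 := hw
  have hrem : R * (η * |a|) ≤ ε := by
    have h1 : η * (R * |a| * (m / 2)) ≤ η * (L + 1) := by gcongr
    have h2 : (R * (η * |a|)) * (m / 2) ≤ ε * (m / 2) := by linarith
    exact le_of_mul_le_mul_right h2 (by positivity)
  have hnorm : ‖v + R • (γ s - γ t - a • g t)‖ ≤ 1 + ε := by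
    refine (norm_add_le _ _).trans ?_
    rw [norm_smul, Real.norm_of_nonneg hR0.le]
    have : R * ‖γ s - γ t - a • g t‖ ≤ R * (η * |a|) := by gcongr
    linarith
  gcongr

lemma Finset.card_le_of_forall_le_add {S : Finset ℕ} {D : ℕ}
    (h : ∀ i ∈ S, ∀ j ∈ S, i ≤ j + D) : S.card ≤ D + 1 := by
  rcases S.eq_empty_or_nonempty with rfl | hS
  · simp
  · have hsub : S ⊆ Finset.Icc (S.min' hS) (S.min' hS + D) := fun i hi =>
      Finset.mem_Icc.2 ⟨S.min'_le i hi, h i hi _ (S.min'_mem hS)⟩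
    refine (Finset.card_le_card hsub).trans ?_
    rw [Nat.card_Icc]
    omega

/-- An `n`-point sampling of an injective curve has boundedly many points in a ball whose radius
is comparable to the sampling distance. -/
lemma card_sample_le {E : Type*} [NormedAddCommGroup E] [NormedSpace ℝ E] {γ : ℝ → E}
    {c Λ L R : ℝ} (hc : 0 < c) (hR : 0 < R) (hL : 2 * L ≤ R * c) (hL0 : 0 < L)
    (hinj : ∀ s ∈ Set.Icc (0 : ℝ) 1, ∀ t ∈ Set.Icc (0 : ℝ) 1, |s - t| ≤ 1 / 2 →
      c * |s - t| ≤ ‖γ s - γ t‖)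
    {n D : ℕ} (hn0 : 0 < n) (hn : (n : ℝ) ≤ 4 * R * Λ / L + 1) (hD : 8 * Λ / c + 1 ≤ D) (x : E) :
    ((Finset.range (n + 1)).filter fun i : ℕ => ‖x - R • γ (i / n)‖ ≤ L).card ≤
      2 * (D + 1) := by
  have hn0' : (0 : ℝ) < n := Nat.cast_pos.2 hn0
  have hnL : n * L ≤ 4 * R * Λ + L := by
    calc n * L ≤ (4 * R * Λ / L + 1) * L := by gcongr
      _ = _ := by field_simp
  have hmem : ∀ i ∈ Finset.range (n + 1), (i / n : ℝ) ∈ Set.Icc (0 : ℝ) 1 := fun i hi =>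
    ⟨by positivity, (div_le_one hn0').2
      (Nat.cast_le.2 (Nat.lt_succ_iff.1 (Finset.mem_range.1 hi)))⟩
  set S := (Finset.range (n + 1)).filter fun i : ℕ => ‖x - R • γ (i / n)‖ ≤ L with hS
  have key : ∀ i ∈ S, ∀ j ∈ S, |(i : ℝ) - j| ≤ n / 2 → i ≤ j + D := by
    intro i hi j hj hij
    obtain ⟨hi, hi'⟩ := Finset.mem_filter.1 hi
    obtain ⟨hj, hj'⟩ := Finset.mem_filter.1 hj
    have e : |(i / n : ℝ) - j / n| = |(i : ℝ) - j| / n := by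
      rw [← sub_div, abs_div, abs_of_pos hn0']
    have h1 := hinj _ (hmem i hi) _ (hmem j hj) (by
      rw [e, div_le_iff₀ hn0']; linarith)
    have h2 : R * ‖γ (i / n) - γ (j / n)‖ ≤ 2 * L := by
      rw [← Real.norm_of_nonneg hR.le, ← norm_smul]
      have : R • (γ (i / n) - γ (j / n)) = (x - R • γ (j / n)) - (x - R • γ (i / n)) := by
        rw [smul_sub]; abel
      rw [this]
      exact (norm_sub_le _ _).trans (by linarith)
    rw [e] at h1
    have h3 : R * (c * |(i : ℝ) - j|) ≤ R * (8 * Λ + c) := by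
      calc R * (c * |(i : ℝ) - j|) = R * (c * (|(i : ℝ) - j| / n)) * n := by field_simp
        _ ≤ R * ‖γ (i / n) - γ (j / n)‖ * n := by gcongr
        _ ≤ 2 * L * n := by gcongr
        _ ≤ R * (8 * Λ + c) := by linarith
    have h4 : c * |(i : ℝ) - j| ≤ c * (8 * Λ / c + 1) := by
      refine (le_of_mul_le_mul_left h3 hR).trans (le_of_eq ?_)
      field_simp
    have h5 : |(i : ℝ) - j| ≤ D := (le_of_mul_le_mul_left h4 hc).trans hD
    have h6 : (i : ℝ) ≤ j + D := by linarith [le_abs_self ((i : ℝ) - j)]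
    exact_mod_cast h6
  have hlt : ∀ i ∈ S, (i : ℝ) ≤ n := fun i hi => Nat.cast_le.2
    (Nat.lt_succ_iff.1 (Finset.mem_range.1 (Finset.mem_filter.1 hi).1))
  rw [← Finset.card_filter_add_card_filter_not (s := S) (fun i => 2 * i ≤ n), two_mul]
  refine add_le_add (Finset.card_le_of_forall_le_add fun i hi j hj => ?_)
    (Finset.card_le_of_forall_le_add fun i hi j hj => ?_)
  · rw [Finset.mem_filter] at hi hj
    have hi2 : (2 : ℝ) * i ≤ n := by exact_mod_cast hi.2
    have hj2 : (2 : ℝ) * j ≤ n := by exact_mod_cast hj.2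
    refine key i hi.1 j hj.1 (abs_le.2 ⟨?_, ?_⟩) <;>
      linarith [(i.cast_nonneg : (0 : ℝ) ≤ i), (j.cast_nonneg : (0 : ℝ) ≤ j)]
  · rw [Finset.mem_filter, not_le] at hi hj
    have hi2 : (n : ℝ) < 2 * i := by exact_mod_cast hi.2
    have hj2 : (n : ℝ) < 2 * j := by exact_mod_cast hj.2
    refine key i hi.1 j hj.1 (abs_le.2 ⟨?_, ?_⟩) <;> linarith [hlt i hi.1, hlt j hj.1]

/-- Sampling the expanded curve: the balls of radius `L` around the sample points cover the
tubular neighborhood with bounded multiplicity, and in each of them the neighborhood is close to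
the unit tube around a tangent line. -/
lemma exists_tube_sampling {N : ℕ} {γ : ℝ → EuclideanSpace ℝ (Fin N)}
    (hγ : ContDiffOn ℝ 1 γ (Set.Icc 0 1))
    (hγ' : ∀ t ∈ Set.Icc (0 : ℝ) 1, derivWithin γ (Set.Icc 0 1) t ≠ 0)
    (hinj : ∀ s ∈ Set.Icc (0 : ℝ) 1, ∀ t ∈ Set.Icc (0 : ℝ) 1, γ s = γ t →
      s = t ∨ (s = 0 ∧ t = 1) ∨ (s = 1 ∧ t = 0))
    (hper : γ 0 = γ 1 → derivWithin γ (Set.Icc 0 1) 0 = derivWithin γ (Set.Icc 0 1) 1) :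
    ∃ K : ℕ, ∀ L ≥ (4 : ℝ), ∀ ε > (0 : ℝ), ∃ R₀ > (0 : ℝ), ∀ R ≥ R₀,
      ∃ (J : Finset ℕ) (a τ : ℕ → EuclideanSpace ℝ (Fin N)), (∀ i ∈ J, ‖τ i‖ = 1) ∧
        (∀ x, (J.filter fun i => ‖x - a i‖ ≤ L).card ≤ K) ∧
        ∀ x ∈ tubularNbhd γ R, (∃ i ∈ J, ‖x - a i‖ ≤ L / 2) ∧
          ∀ i ∈ J, ‖x - a i‖ ≤ L → ‖x - a i‖ ^ 2 - ⟪x - a i, τ i⟫ ^ 2 ≤ (1 + ε) ^ 2 := by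
  set g := derivWithin γ (Set.Icc 0 1)
  have hg : ContinuousOn g (Set.Icc 0 1) :=
    hγ.continuousOn_derivWithin (uniqueDiffOn_Icc zero_lt_one) le_rfl
  have hd : ∀ t ∈ Set.Icc (0 : ℝ) 1, HasDerivWithinAt γ (g t) (Set.Icc 0 1) t := fun t ht =>
    (hγ.differentiableOn (by simp) t ht).hasDerivWithinAt
  obtain ⟨c, hc, hcinj⟩ := exists_injectivity_bound hg hd hγ' hinj
  obtain ⟨Λ, hΛ, hlip⟩ := exists_lipschitz_bound hg hd
  refine ⟨2 * (⌈8 * Λ / c + 1⌉₊ + 1), fun L hL ε hε => ?_⟩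
  have hL0 : 0 < L := by linarith
  obtain ⟨R₁, hR₁, htan⟩ := exists_dist_tangent_line_le hg hd hγ' hinj hper hL0 hε
  refine ⟨max R₁ (2 * L / c), by positivity, fun R hR => ?_⟩
  have hRR₁ : R₁ ≤ R := (le_max_left _ _).trans hR
  have hR0 : 0 < R := hR₁.trans_le hRR₁
  have hRc : 2 * L ≤ R * c := by
    rw [← div_le_iff₀ hc]; exact (le_max_right _ _).trans hR
  set n := ⌈4 * R * Λ / L⌉₊
  have hn0 : 0 < n := Nat.ceil_pos.2 (by positivity)
  have hn0' : (0 : ℝ) < n := Nat.cast_pos.2 hn0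
  have hmem : ∀ i ∈ Finset.range (n + 1), (i / n : ℝ) ∈ Set.Icc (0 : ℝ) 1 := fun i hi =>
    ⟨by positivity, (div_le_one hn0').2
      (Nat.cast_le.2 (Nat.lt_succ_iff.1 (Finset.mem_range.1 hi)))⟩
  refine ⟨Finset.range (n + 1), fun i => R • γ (i / n), fun i => ‖g (i / n)‖⁻¹ • g (i / n),
    fun i hi => ?_, fun x => card_sample_le hc hR0 hRc hL0 hcinj hn0
      (Nat.ceil_lt_add_one (by positivity)).le (Nat.le_ceil _) x, fun x hx => ?_⟩
  · rw [norm_smul, norm_inv, norm_norm, inv_mul_cancel₀ (norm_ne_zero_iff.2 (hγ' _ (hmem i hi)))]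
  have hx' := interior_subset hx
  simp only [Set.mem_iUnion, Set.mem_ofPred_eq] at hx'
  obtain ⟨t, ht, v, rfl, hv, -⟩ := hx'
  refine ⟨⟨⌊t * n⌋₊, ?_, ?_⟩, fun i hi hle => htan R hRR₁ t ht _ (hmem i hi) v hv hle⟩
  · rw [Finset.mem_range, Nat.lt_succ_iff]
    refine Nat.floor_le_of_le ?_
    nlinarith [ht.2]
  · have hi : ⌊t * n⌋₊ ∈ Finset.range (n + 1) := by
      rw [Finset.mem_range, Nat.lt_succ_iff]
      refine Nat.floor_le_of_le ?_
      nlinarith [ht.2]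
    have htn : |t - ⌊t * n⌋₊ / n| ≤ 1 / n := by
      have h0 : 0 ≤ t * n := mul_nonneg ht.1 hn0'.le
      have h1 := Nat.floor_le h0
      have h2 := Nat.lt_floor_add_one (t * n)
      have e : t - ⌊t * n⌋₊ / n = (t * n - ⌊t * n⌋₊) / n := by field_simp
      rw [e, abs_div, abs_of_pos hn0', abs_of_nonneg (by linarith)]
      gcongr
      linarith
    have hRΛ : R * (Λ * (1 / n)) ≤ L / 4 := by
      have h1 : 4 * R * Λ / L ≤ n := Nat.le_ceil _
      rw [div_le_iff₀ hL0] at h1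
      rw [mul_one_div, ← mul_div_assoc, div_le_iff₀ hn0']
      linarith
    have e : R • γ t + v - R • γ (⌊t * n⌋₊ / n) = R • (γ t - γ (⌊t * n⌋₊ / n)) + v := by
      rw [smul_sub]; abel
    rw [e]
    refine (norm_add_le _ _).trans ?_
    rw [norm_smul, Real.norm_of_nonneg hR0.le]
    have h1 : R * ‖γ t - γ (⌊t * n⌋₊ / n)‖ ≤ R * (Λ * (1 / n)) := by
      gcongr
      exact (hlip t ht _ (hmem _ hi)).trans (by gcongr)
    linarith

/-- Contribution of one localized tube to the supersolution inequality. -/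
lemma le_neg_laplacian_mul_comp {N : ℕ} (hN : 1 ≤ N) {f k : ℝ → ℝ} (hf : ContDiff ℝ 2 f)
    (hk : ContDiff ℝ 2 k) {μ lam : ℝ}
    (ode : ∀ s, 4 * s * deriv (deriv f) s + 2 * ((N - 1 : ℕ) : ℝ) * deriv f s + μ * f s = 0)
    (a τ : EuclideanSpace ℝ (Fin N)) (hτ : ‖τ‖ = 1) (x : EuclideanSpace ℝ (Fin N)) {p q : ℝ}
    (hp : p = ‖x - a‖ ^ 2) (hq : q = ‖x - a‖ ^ 2 - ⟪x - a, τ⟫ ^ 2) (hq0 : 0 ≤ q) (hq4 : q ≤ 4)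
    {B H : ℝ} (hB : |f q| ≤ B) (hB' : |deriv f q| ≤ B) (hH : |deriv k p| ≤ H)
    (hH' : p * |deriv (deriv k) p| ≤ H) :
    (μ + lam) * (f q * k p) - (36 + 2 * N) * (B * H) ≤
      -laplacian (fun x => f (‖x - a‖ ^ 2 - ⟪x - a, τ⟫ ^ 2) * k (‖x - a‖ ^ 2)) x +
        lam * (f (‖x - a‖ ^ 2 - ⟪x - a, τ⟫ ^ 2) * k (‖x - a‖ ^ 2)) := by
  rw [laplacian_mul_comp hf hk a τ hτ x hp hq, ← hq, ← hp]
  have hode := ode q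
  rw [Nat.cast_sub hN, Nat.cast_one] at hode
  have hp0 : 0 ≤ p := by rw [hp]; positivity
  have hB0 : 0 ≤ B := (abs_nonneg _).trans hB
  have hH0 : 0 ≤ H := (abs_nonneg _).trans hH
  have e1 : q * (deriv f q * deriv k p) ≤ 4 * (B * H) := by
    refine (le_abs_self _).trans ?_
    rw [abs_mul, abs_mul, abs_of_nonneg hq0]
    gcongr
  have e2 : f q * (p * deriv (deriv k) p) ≤ B * H := by
    refine (le_abs_self _).trans ?_
    rw [abs_mul, abs_mul, abs_of_nonneg hp0]
    gcongr
  have e3 : f q * deriv k p ≤ B * H := by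
    refine (le_abs_self _).trans ?_
    rw [abs_mul]
    gcongr
  have e4 : (N : ℝ) * (f q * deriv k p) ≤ N * (B * H) := by gcongr
  have e5 : 4 * q * deriv (deriv f) q + 2 * (N - 1) * deriv f q = -(μ * f q) := by linarith
  rw [e5]
  linarith

lemma exists_supersolution_of_cover {N : ℕ} (hN : 2 ≤ N) {lam : ℝ}
    (hlam : -(rayleighQuotientInf (Metric.ball (0 : EuclideanSpace ℝ (Fin (N - 1))) 1)) < lam)
    (K : ℕ) :
    ∃ ε > (0 : ℝ), ∃ L ≥ (4 : ℝ), ∀ (J : Finset ℕ) (a τ : ℕ → EuclideanSpace ℝ (Fin N))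
      (Ω : Set (EuclideanSpace ℝ (Fin N))), (∀ i ∈ J, ‖τ i‖ = 1) →
      (∀ x, (J.filter fun i => ‖x - a i‖ ≤ L).card ≤ K) →
      (∀ x ∈ Ω, (∃ i ∈ J, ‖x - a i‖ ≤ L / 2) ∧
        ∀ i ∈ J, ‖x - a i‖ ≤ L → ‖x - a i‖ ^ 2 - ⟪x - a i, τ i⟫ ^ 2 ≤ (1 + ε) ^ 2) →
      ∃ W : EuclideanSpace ℝ (Fin N) → ℝ, ContDiff ℝ 2 W ∧ (∃ c > (0 : ℝ), ∀ x ∈ Ω, c ≤ W x) ∧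
        ∀ x ∈ Ω, 0 < -laplacian W x + lam * W x := by
  set lam₁ := rayleighQuotientInf (Metric.ball (0 : EuclideanSpace ℝ (Fin (N - 1))) 1)
  let μ : ℝ := (lam₁ - lam) / 2
  have hμ : μ < lam₁ := by simp only [μ]; linarith
  have hδ : 0 < μ + lam := by simp only [μ]; linarith
  obtain ⟨f, hf, f0, ode⟩ := exists_radial_eigenfunction (d := N - 1) (by omega) μ
  have hf2 : ContDiff ℝ 2 f := contDiff_infty.1 hf 2
  have fpos : ∀ s ∈ Set.Icc (0 : ℝ) 1, 0 < f s := radial_eigenfunction_pos hμ hf f0 ode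
  obtain ⟨ε, hε, hε1, hεpos⟩ : ∃ ε > (0 : ℝ), ε ≤ 1 ∧
      ∀ s ∈ Set.Icc (0 : ℝ) ((1 + ε) ^ 2), 0 < f s := by
    obtain ⟨r, hr, hball⟩ := Metric.eventually_nhds_iff.1
      (hf.continuous.continuousAt.eventually (lt_mem_nhds (fpos 1 (by norm_num))))
    refine ⟨min 1 (r / 4), by positivity, min_le_left _ _, fun s hs => ?_⟩
    by_cases h1 : s ≤ 1
    · exact fpos s ⟨hs.1, h1⟩
    · refine hball ?_
      have := hs.2
      have hr4 : min 1 (r / 4) ≤ r / 4 := min_le_right _ _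
      have hr1 : min 1 (r / 4) ≤ 1 := min_le_left _ _
      have hr0 : 0 < min 1 (r / 4) := by positivity
      rw [Real.dist_eq, abs_of_pos (by linarith)]
      nlinarith
  have hε4 : (1 + ε) ^ 2 ≤ 4 := by nlinarith
  obtain ⟨b, hb, hfb⟩ := (isCompact_Icc (a := (0 : ℝ)) (b := (1 + ε) ^ 2)).exists_forall_le'
    hf.continuous.continuousOn hεpos
  have hf' : Continuous (deriv f) := (ContDiff.deriv' (n := 1) hf2).continuous
  obtain ⟨B₁, hB₁⟩ := (isCompact_Icc (a := (0 : ℝ)) (b := 4)).exists_bound_of_continuousOn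
    hf.continuous.continuousOn
  obtain ⟨B₂, hB₂⟩ := (isCompact_Icc (a := (0 : ℝ)) (b := 4)).exists_bound_of_continuousOn
    hf'.continuousOn
  set B := max B₁ B₂ with hB
  have hB0 : 0 ≤ B := ((norm_nonneg _).trans (hB₁ 0 (by norm_num))).trans (le_max_left _ _)
  obtain ⟨H, hH, hcut⟩ := exists_scaled_cutoff
  set C := (36 + 2 * N) * (B * H) with hC
  have hC0 : 0 ≤ C := by positivity
  let L : ℝ := max 4 (K * C / ((μ + lam) * b) + 1)
  have hL4 : 4 ≤ L := le_max_left _ _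
  have hL0 : 0 < L := by linarith
  have hKL : K * C / L ^ 2 < (μ + lam) * b := by
    have h1 : K * C / ((μ + lam) * b) < L := by
      have : K * C / ((μ + lam) * b) + 1 ≤ L := le_max_right _ _
      linarith
    rw [div_lt_iff₀ (by positivity)] at h1 ⊢
    have h2 : 0 < (μ + lam) * b := by positivity
    nlinarith [mul_pos h2 hL0]
  obtain ⟨k, hk, hk0, hk1, hkz, hkb⟩ := hcut L hL0
  refine ⟨ε, hε, L, hL4, fun J a τ Ω hτ hcard hΩ => ?_⟩
  let T : ℕ → EuclideanSpace ℝ (Fin N) → ℝ := fun i x =>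
    f (‖x - a i‖ ^ 2 - ⟪x - a i, τ i⟫ ^ 2) * k (‖x - a i‖ ^ 2)
  have hT : ∀ i, ContDiff ℝ 2 (T i) := fun i => by
    have h1 : ContDiff ℝ 2 fun x : EuclideanSpace ℝ (Fin N) => ‖x - a i‖ ^ 2 :=
      (contDiff_id.sub contDiff_const).norm_sq ℝ
    have h2 : ContDiff ℝ 2 fun x : EuclideanSpace ℝ (Fin N) => ⟪x - a i, τ i⟫ :=
      (contDiff_id.sub contDiff_const).inner ℝ contDiff_const
    exact (hf2.comp (h1.sub (h2.pow 2))).mul (hk.comp h1)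
  have hq0 : ∀ i ∈ J, ∀ x, 0 ≤ ‖x - a i‖ ^ 2 - ⟪x - a i, τ i⟫ ^ 2 := fun i hi x => by
    have := abs_real_inner_le_norm (x - a i) (τ i)
    rw [hτ i hi, mul_one] at this
    rw [← sq_abs ⟪x - a i, τ i⟫]
    have : |⟪x - a i, τ i⟫| ^ 2 ≤ ‖x - a i‖ ^ 2 := by gcongr
    linarith
  have hfar : ∀ i, ∀ x, L < ‖x - a i‖ → L ^ 2 < ‖x - a i‖ ^ 2 := fun i x hx => by gcongr
  have hTfar : ∀ i ∈ J, ∀ x, L < ‖x - a i‖ → T i x = 0 ∧ laplacian (T i) x = 0 :=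
    fun i hi x hx => by
      obtain ⟨z0, z1, z2⟩ := hkz _ (hfar i x hx)
      refine ⟨by simp [T, z0], ?_⟩
      rw [laplacian_mul_comp hf2 hk (a i) (τ i) (hτ i hi) x rfl rfl, z0, z1, z2]
      ring
  have hTnear : ∀ x ∈ Ω, ∀ i ∈ J, ‖x - a i‖ ≤ L → 0 ≤ T i x ∧
      (μ + lam) * T i x - C / L ^ 2 ≤ -laplacian (T i) x + lam * T i x := fun x hx i hi hle => by
    have hq := (hΩ x hx).2 i hi hle
    have hq4 := hq.trans hε4
    refine ⟨mul_nonneg (hεpos _ ⟨hq0 i hi x, hq⟩).le (hk0 _), ?_⟩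
    obtain ⟨d1, d2⟩ := hkb (‖x - a i‖ ^ 2) (by positivity) (by gcongr)
    have := le_neg_laplacian_mul_comp (lam := lam) (by omega) hf2 hk ode (a i) (τ i) (hτ i hi) x
      rfl rfl (hq0 i hi x) hq4 ((hB₁ _ ⟨hq0 i hi x, hq4⟩).trans (le_max_left B₁ B₂))
      ((hB₂ _ ⟨hq0 i hi x, hq4⟩).trans (le_max_right B₁ B₂)) d1 d2
    rw [← hB, ← mul_div_assoc B, ← mul_div_assoc (36 + 2 * (N : ℝ)), ← hC] at this
    exact this
  have hTnonneg : ∀ x ∈ Ω, ∀ i ∈ J, 0 ≤ T i x := fun x hx i hi => by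
    rcases le_or_gt ‖x - a i‖ L with h | h
    · exact (hTnear x hx i hi h).1
    · exact (hTfar i hi x h).1.ge
  have hTbig : ∀ x ∈ Ω, ∃ i ∈ J, ‖x - a i‖ ≤ L ∧ b ≤ T i x := fun x hx => by
    obtain ⟨⟨i, hi, hle⟩, hthin⟩ := hΩ x hx
    have hle' : ‖x - a i‖ ≤ L := by linarith
    refine ⟨i, hi, hle', ?_⟩
    have hs : ‖x - a i‖ ^ 2 ≤ L ^ 2 / 2 := by
      have : ‖x - a i‖ ^ 2 ≤ (L / 2) ^ 2 := by gcongr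
      nlinarith
    simp only [T]
    rw [hk1 _ hs, mul_one]
    exact hfb _ ⟨hq0 i hi x, hthin i hi hle'⟩
  refine ⟨fun x => ∑ i ∈ J, T i x, ContDiff.sum fun i _ => hT i, ⟨b, hb, fun x hx => ?_⟩,
    fun x hx => ?_⟩
  · obtain ⟨i, hi, -, hbi⟩ := hTbig x hx
    exact hbi.trans (Finset.single_le_sum (f := fun i => T i x) (hTnonneg x hx) hi)
  · rw [laplacian_sum J (fun i _ => hT i), Finset.mul_sum, ← Finset.sum_neg_distrib,
      ← Finset.sum_add_distrib]
    set S := J.filter fun i => ‖x - a i‖ ≤ L with hS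
    have hSJ : S ⊆ J := Finset.filter_subset _ _
    rw [← Finset.sum_subset hSJ fun i hi hiS => by
      have hlt : L < ‖x - a i‖ := by
        by_contra hcon
        exact hiS (Finset.mem_filter.2 ⟨hi, not_lt.1 hcon⟩)
      rw [(hTfar i hi x hlt).1, (hTfar i hi x hlt).2]
      simp]
    obtain ⟨i, hi, hle, hbi⟩ := hTbig x hx
    have hsum : b ≤ ∑ i ∈ S, T i x :=
      hbi.trans (Finset.single_le_sum (f := fun i => T i x)
        (fun j hj => hTnonneg x hx j (hSJ hj)) (Finset.mem_filter.2 ⟨hi, hle⟩))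
    have hcount : (S.card : ℝ) * (C / L ^ 2) ≤ K * (C / L ^ 2) := by
      gcongr
      exact hcard x
    calc (0 : ℝ) < (μ + lam) * b - K * (C / L ^ 2) := by
          rw [← mul_div_assoc]; linarith
      _ ≤ (μ + lam) * ∑ i ∈ S, T i x - S.card * (C / L ^ 2) := by
          have := mul_le_mul_of_nonneg_left hsum hδ.le
          linarith
      _ = ∑ i ∈ S, ((μ + lam) * T i x - C / L ^ 2) := by
          rw [Finset.sum_sub_distrib, ← Finset.mul_sum, Finset.sum_const, nsmul_eq_mul]
      _ ≤ _ := Finset.sum_le_sum fun j hj => by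
          obtain ⟨h1, h2⟩ := Finset.mem_filter.1 hj
          exact (hTnear x hx j h1 h2).2

theorem stmt_14 (N : ℕ) (hN : 2 ≤ N) (γ : ℝ → EuclideanSpace ℝ (Fin N))
    (hγ : ContDiffOn ℝ 3 γ (Set.Icc 0 1))
    (hγ' : ∀ t ∈ Set.Icc (0 : ℝ) 1, derivWithin γ (Set.Icc 0 1) t ≠ 0)
    (hinj : ∀ s ∈ Set.Icc (0 : ℝ) 1, ∀ t ∈ Set.Icc (0 : ℝ) 1, γ s = γ t →
      s = t ∨ (s = 0 ∧ t = 1) ∨ (s = 1 ∧ t = 0))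
    (hper : γ 0 = γ 1 → derivWithin γ (Set.Icc 0 1) 0 = derivWithin γ (Set.Icc 0 1) 1)
    (lam : ℝ)
    (hlam : -(rayleighQuotientInf (Metric.ball (0 : EuclideanSpace ℝ (Fin (N - 1))) 1)) < lam) :
    ∃ R₀ > (0 : ℝ), ∀ R ≥ R₀, ∃ W : EuclideanSpace ℝ (Fin N) → ℝ,
      ContDiffOn ℝ 2 W (tubularNbhd γ R) ∧
      ContinuousOn W (closure (tubularNbhd γ R)) ∧
      (∃ c > (0 : ℝ), ∀ x ∈ closure (tubularNbhd γ R), c ≤ W x) ∧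
      ∀ x ∈ tubularNbhd γ R, 0 < -laplacian W x + lam * W x := by
  obtain ⟨K, hK⟩ := exists_tube_sampling (hγ.of_le (by norm_num)) hγ' hinj hper
  obtain ⟨ε, hε, L, hL, hW⟩ := exists_supersolution_of_cover hN hlam K
  obtain ⟨R₀, hR₀, hR⟩ := hK L hL ε hε
  refine ⟨R₀, hR₀, fun R hRR => ?_⟩
  obtain ⟨J, a, τ, hτ, hcard, hcover⟩ := hR R hRR
  obtain ⟨W, hWc, ⟨c, hc, hcW⟩, hlap⟩ := hW J a τ _ hτ hcard hcover
  exact ⟨W, hWc.contDiffOn, hWc.continuous.continuousOn,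
    ⟨c, hc, fun x hx => closure_minimal hcW (isClosed_le continuous_const hWc.continuous) hx⟩,
    hlap⟩
end

section
/- Let μ > 0 and a, b ≥ 0. Then ∫_ℝ max{ e^{−2μ(a+|ξ+a|)}, e^{−2μ(b+|ξ−b|)} } dξ = (1/μ)( e^{−2μa} − e^{−2μ(a+b)} + e^{−2μb} ), and consequently this integral is greater than or equal to (1/μ) e^{−2μ·min{a,b}}. -/
open MeasureTheory

lemma integrableOn_exp_neg_abs_sub_Ioi {μ b c : ℝ} (hμ : 0 < μ) :
    IntegrableOn (fun ξ : ℝ => Real.exp (-2 * μ * (b + |ξ - b|))) (Set.Ioi c) := by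
  refine integrable_of_isBigO_exp_neg (b := 2 * μ) (by positivity) (by fun_prop) ?_
  refine Filter.EventuallyEq.trans_isBigO (g := fun x => Real.exp (-(2 * μ) * x)) ?_
    (Asymptotics.isBigO_refl _ _)
  filter_upwards [Filter.eventually_ge_atTop b] with x hx
  rw [abs_of_nonneg (by linarith)]
  congr 1
  ring

lemma integral_Ioi_exp_neg_abs_sub {μ b c : ℝ} (hμ : 0 < μ) (hc : c ≤ b) :
    ∫ ξ in Set.Ioi c, Real.exp (-2 * μ * (b + |ξ - b|))
      = (2 * Real.exp (-2 * μ * b) - Real.exp (-2 * μ * (2 * b - c))) / (2 * μ) := by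
  have hI : ∀ d, IntegrableOn (fun ξ : ℝ => Real.exp (-2 * μ * (b + |ξ - b|))) (Set.Ioi d) :=
    fun _ => integrableOn_exp_neg_abs_sub_Ioi hμ
  rw [← intervalIntegral.integral_interval_add_Ioi (hI c) (hI b)]
  have h1 : ∫ ξ in c..b, Real.exp (-2 * μ * (b + |ξ - b|))
      = (Real.exp (-2 * μ * b) - Real.exp (-2 * μ * (2 * b - c))) / (2 * μ) := by
    have : ∫ ξ in c..b, Real.exp (-2 * μ * (b + |ξ - b|))
        = ∫ ξ in c..b, Real.exp (-2 * μ * (2 * b - ξ)) := by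
      refine intervalIntegral.integral_congr fun x hx => ?_
      rw [Set.uIcc_of_le hc] at hx
      rw [abs_of_nonpos (by linarith [hx.2])]
      congr 1
      ring
    rw [this, intervalIntegral.integral_eq_sub_of_hasDerivAt
      (f := fun ξ => Real.exp (-2 * μ * (2 * b - ξ)) / (2 * μ))]
    · ring_nf
    · intro x _
      have h := ((((hasDerivAt_id' x).const_sub (2 * b)).const_mul (-2 * μ)).exp).div_const (2 * μ)
      refine h.congr_deriv ?_
      field_simp
    · exact (by fun_prop : Continuous _).intervalIntegrable _ _
  have h2 : ∫ ξ in Set.Ioi b, Real.exp (-2 * μ * (b + |ξ - b|))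
      = Real.exp (-2 * μ * b) / (2 * μ) := by
    have : ∫ ξ in Set.Ioi b, Real.exp (-2 * μ * (b + |ξ - b|))
        = ∫ ξ in Set.Ioi b, Real.exp ((-2 * μ) * ξ) := by
      refine setIntegral_congr_fun measurableSet_Ioi fun x hx => ?_
      rw [abs_of_nonneg (by linarith [Set.mem_Ioi.mp hx])]
      congr 1
      ring
    rw [this, integral_exp_mul_Ioi (by linarith)]
    field_simp
  rw [h1, h2]
  ring

lemma add_abs_add_le_add_abs_sub {a b x : ℝ} (ha : 0 ≤ a) (hb : 0 ≤ b) (hx : x ≤ b - a) :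
    a + |x + a| ≤ b + |x - b| := by
  rw [abs_of_nonpos (by linarith : x - b ≤ 0)]
  rcases abs_cases (x + a) with h | h <;> linarith

lemma add_abs_sub_le_add_abs_add {a b x : ℝ} (ha : 0 ≤ a) (hb : 0 ≤ b) (hx : b - a ≤ x) :
    b + |x - b| ≤ a + |x + a| := by
  rw [abs_of_nonneg (by linarith : 0 ≤ x + a)]
  rcases abs_cases (x - b) with h | h <;> linarith

lemma integral_max_exp_neg_abs {μ a b : ℝ} (hμ : 0 < μ) (ha : 0 ≤ a) (hb : 0 ≤ b) :
    (∫ ξ : ℝ, max (Real.exp (-2 * μ * (a + |ξ + a|))) (Real.exp (-2 * μ * (b + |ξ - b|))))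
        = (1 / μ) * (Real.exp (-2 * μ * a) - Real.exp (-2 * μ * (a + b))
            + Real.exp (-2 * μ * b)) := by
  have hμ' : -2 * μ ≤ 0 := by linarith
  have hreflect : ∀ x : ℝ, |-x + a| = |x - a| := fun x => by rw [← abs_neg]; congr 1; ring
  have hL : Set.EqOn (fun ξ : ℝ => max (Real.exp (-2 * μ * (a + |ξ + a|)))
      (Real.exp (-2 * μ * (b + |ξ - b|)))) (fun ξ => Real.exp (-2 * μ * (a + |ξ + a|)))
      (Set.Iic (b - a)) := fun x hx => max_eq_left <| Real.exp_le_exp.mpr <|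
    mul_le_mul_of_nonpos_left (add_abs_add_le_add_abs_sub ha hb hx) hμ'
  have hR : Set.EqOn (fun ξ : ℝ => max (Real.exp (-2 * μ * (a + |ξ + a|)))
      (Real.exp (-2 * μ * (b + |ξ - b|)))) (fun ξ => Real.exp (-2 * μ * (b + |ξ - b|)))
      (Set.Ioi (b - a)) := fun x hx => max_eq_right <| Real.exp_le_exp.mpr <|
    mul_le_mul_of_nonpos_left (add_abs_sub_le_add_abs_add ha hb (le_of_lt hx)) hμ'
  have hLi : IntegrableOn (fun ξ : ℝ => Real.exp (-2 * μ * (a + |ξ + a|))) (Set.Iic (b - a)) := by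
    have h := integrableOn_exp_neg_abs_sub_Ioi (b := a) (c := -(b - a)) hμ
    rw [← integrableOn_Ici_iff_integrableOn_Ioi] at h
    have h' := h.comp_neg
    simpa [← hreflect] using h'
  rw [← intervalIntegral.integral_Iic_add_Ioi
      (hLi.congr_fun hL.symm measurableSet_Iic)
      ((integrableOn_exp_neg_abs_sub_Ioi hμ).congr_fun hR.symm measurableSet_Ioi),
    setIntegral_congr_fun measurableSet_Iic hL, setIntegral_congr_fun measurableSet_Ioi hR,
    integral_Ioi_exp_neg_abs_sub hμ (by linarith)]
  have h := integral_comp_neg_Ioi (-(b - a)) (fun ξ : ℝ => Real.exp (-2 * μ * (a + |ξ + a|)))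
  simp only [hreflect, neg_neg] at h
  rw [← h, integral_Ioi_exp_neg_abs_sub hμ (by linarith),
    show 2 * a - -(b - a) = a + b by ring, show 2 * b - (b - a) = a + b by ring]
  field_simp
  ring

theorem stmt_16 (μ a b : ℝ) (hμ : 0 < μ) (ha : 0 ≤ a) (hb : 0 ≤ b) :
    (∫ ξ : ℝ, max (Real.exp (-2 * μ * (a + |ξ + a|))) (Real.exp (-2 * μ * (b + |ξ - b|))))
        = (1 / μ) * (Real.exp (-2 * μ * a) - Real.exp (-2 * μ * (a + b))
            + Real.exp (-2 * μ * b)) ∧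
    (1 / μ) * Real.exp (-2 * μ * min a b)
      ≤ ∫ ξ : ℝ, max (Real.exp (-2 * μ * (a + |ξ + a|)))
          (Real.exp (-2 * μ * (b + |ξ - b|))) := by
  refine ⟨integral_max_exp_neg_abs hμ ha hb, ?_⟩
  rw [integral_max_exp_neg_abs hμ ha hb]
  refine mul_le_mul_of_nonneg_left ?_ (by positivity)
  have hA : Real.exp (-2 * μ * (a + b)) ≤ Real.exp (-2 * μ * a) :=
    Real.exp_le_exp.mpr (by nlinarith)
  have hB : Real.exp (-2 * μ * (a + b)) ≤ Real.exp (-2 * μ * b) :=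
    Real.exp_le_exp.mpr (by nlinarith)
  rcases min_choice a b with h | h <;> rw [h] <;> linarith
end

section
/- Let x₁, x₂, x₃ ∈ ℝ^N and g > 0 be such that |x_i − x_j| ≥ g for all i ≠ j. Assume that either (a) some pairwise distance satisfies |x_i − x_j| ≥ 2g, or (b) one of the interior angles of the triangle with vertices x₁, x₂, x₃ is greater than or equal to 2π/3. Then for every x ∈ ℝ^N one has |x−x₁| + |x−x₂| + |x−x₃| ≥ 2g. -/
/-- If two vectors form an angle of at least `2π/3`, the sum of the corresponding unit vectors has
norm at most one. -/
theorem norm_unit_add_unit_le_one {V : Type*} [NormedAddCommGroup V] [InnerProductSpace ℝ V]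
    {a b : V} (ha : a ≠ 0) (hb : b ≠ 0) (h : 2 * Real.pi / 3 ≤ InnerProductGeometry.angle a b) :
    ‖‖a‖⁻¹ • a + ‖b‖⁻¹ • b‖ ≤ 1 := by
  have hu : ‖‖a‖⁻¹ • a‖ = 1 := norm_smul_inv_norm (𝕜 := ℝ) ha
  have hv : ‖‖b‖⁻¹ • b‖ = 1 := norm_smul_inv_norm (𝕜 := ℝ) hb
  have hcos : Real.cos (InnerProductGeometry.angle a b) ≤ -(1 / 2) := by
    have hle := Real.cos_le_cos_of_nonneg_of_le_pi (by positivity)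
      (InnerProductGeometry.angle_le_pi a b) h
    rwa [show 2 * Real.pi / 3 = Real.pi - Real.pi / 3 by ring, Real.cos_pi_sub,
      Real.cos_pi_div_three] at hle
  have hinner : inner ℝ (‖a‖⁻¹ • a) (‖b‖⁻¹ • b) ≤ -(1 / 2) := by
    rw [InnerProductGeometry.cos_angle] at hcos
    rw [real_inner_smul_left, real_inner_smul_right]
    convert hcos using 1
    field_simp
  have hsq := norm_add_sq_real (‖a‖⁻¹ • a) (‖b‖⁻¹ • b)
  rw [hu, hv] at hsq
  exact abs_le_one_iff_mul_self_le_one.2 (by nlinarith) |> (le_abs_self _).trans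

theorem norm_sub_inner_unit_le {V : Type*} [NormedAddCommGroup V] [InnerProductSpace ℝ V]
    {a : V} (ha : a ≠ 0) (y : V) : ‖a‖ - inner ℝ y (‖a‖⁻¹ • a) ≤ ‖y - a‖ := by
  have hu : ‖‖a‖⁻¹ • a‖ = 1 := norm_smul_inv_norm (𝕜 := ℝ) ha
  have hle := real_inner_le_norm (a - y) (‖a‖⁻¹ • a)
  have haa : inner ℝ a (‖a‖⁻¹ • a) = ‖a‖ := by
    have : ‖a‖ ≠ 0 := norm_ne_zero_iff.2 ha
    rw [real_inner_smul_right, real_inner_self_eq_norm_sq]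
    field_simp
  rwa [hu, mul_one, inner_sub_left, haa, norm_sub_rev] at hle

/-- A vertex whose interior angle is at least `2π/3` minimizes the sum of the distances to the
vertices of the triangle. -/
theorem dist_add_dist_le_of_two_pi_div_three_le_angle {V P : Type*} [NormedAddCommGroup V]
    [InnerProductSpace ℝ V] [MetricSpace P] [NormedAddTorsor V P] {a p b : P}
    (ha : a ≠ p) (hb : b ≠ p) (h : 2 * Real.pi / 3 ≤ EuclideanGeometry.angle a p b) (x : P) :
    dist p a + dist p b ≤ dist x p + dist x a + dist x b := by
  have ha' : a -ᵥ p ≠ 0 := vsub_ne_zero.2 ha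
  have hb' : b -ᵥ p ≠ 0 := vsub_ne_zero.2 hb
  have h1 := norm_sub_inner_unit_le ha' (x -ᵥ p)
  have h2 := norm_sub_inner_unit_le hb' (x -ᵥ p)
  have h3 := (real_inner_le_norm (x -ᵥ p) _).trans
    (mul_le_of_le_one_right (norm_nonneg _) (norm_unit_add_unit_le_one ha' hb' h))
  rw [inner_add_right] at h3
  rw [vsub_sub_vsub_cancel_right] at h1 h2
  rw [dist_comm p a, dist_comm p b]
  simp only [dist_eq_norm_vsub V]
  linarith

theorem stmt_18 (N : ℕ) (x₁ x₂ x₃ : EuclideanSpace ℝ (Fin N)) (g : ℝ) (hg : 0 < g)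
    (hd12 : g ≤ dist x₁ x₂) (hd13 : g ≤ dist x₁ x₃) (hd23 : g ≤ dist x₂ x₃)
    (h : (2 * g ≤ dist x₁ x₂ ∨ 2 * g ≤ dist x₁ x₃ ∨ 2 * g ≤ dist x₂ x₃) ∨
         (2 * Real.pi / 3 ≤ EuclideanGeometry.angle x₂ x₁ x₃ ∨
          2 * Real.pi / 3 ≤ EuclideanGeometry.angle x₁ x₂ x₃ ∨
          2 * Real.pi / 3 ≤ EuclideanGeometry.angle x₁ x₃ x₂)) :
    ∀ x : EuclideanSpace ℝ (Fin N), 2 * g ≤ dist x x₁ + dist x x₂ + dist x x₃ := by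
  intro x
  have h12 : x₁ ≠ x₂ := dist_pos.1 (hg.trans_le hd12)
  have h13 : x₁ ≠ x₃ := dist_pos.1 (hg.trans_le hd13)
  have h23 : x₂ ≠ x₃ := dist_pos.1 (hg.trans_le hd23)
  rcases h with (h | h | h) | (h | h | h)
  · linarith [dist_triangle_left x₁ x₂ x, dist_nonneg (x := x) (y := x₃)]
  · linarith [dist_triangle_left x₁ x₃ x, dist_nonneg (x := x) (y := x₂)]
  · linarith [dist_triangle_left x₂ x₃ x, dist_nonneg (x := x) (y := x₁)]
  · linarith [dist_add_dist_le_of_two_pi_div_three_le_angle h12.symm h13.symm h x]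
  · linarith [dist_add_dist_le_of_two_pi_div_three_le_angle h12 h23.symm h x, dist_comm x₁ x₂]
  · linarith [dist_add_dist_le_of_two_pi_div_three_le_angle h13 h23 h x, dist_comm x₁ x₃,
      dist_comm x₂ x₃]
end

section
/- Let N ≥ 2 and let γ : ℝ → ℝ^N be 1-periodic, three times continuously differentiable, with γ'(t) ≠ 0 for all t, and injective on [0,1). Let Γ := γ([0,1]). Then there exists ϱ > 0 such that whenever x, y, z ∈ Γ are three pairwise distinct points with |x−y| < 2ϱ and |z−y| < 2ϱ, one of the interior angles of the triangle with vertices x, y, z is larger than 2π/3. -/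
/-- Two vectors that are close to positive multiples of the same vector make an angle with
cosine larger than one half. -/
lemma norm_mul_norm_lt_two_mul_inner {E : Type*} [NormedAddCommGroup E] [InnerProductSpace ℝ E]
    {u w v : E} {p q : ℝ} (hp : 0 < p) (hq : 0 < q) (hv : v ≠ 0)
    (hu : ‖u - p • v‖ ≤ ‖v‖ / 10 * p) (hw : ‖w - q • v‖ ≤ ‖v‖ / 10 * q) :
    ‖u‖ * ‖w‖ < 2 * inner ℝ u w := by
  have hv0 : 0 < ‖v‖ := norm_pos_iff.mpr hv
  obtain ⟨e, rfl⟩ : ∃ e, u = p • v + e := ⟨u - p • v, by abel⟩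
  obtain ⟨f, rfl⟩ : ∃ f, w = q • v + f := ⟨w - q • v, by abel⟩
  rw [add_sub_cancel_left] at hu hw
  have hnu : ‖p • v + e‖ ≤ 11 / 10 * (‖v‖ * p) := by
    have := norm_add_le (p • v) e
    rw [norm_smul, Real.norm_of_nonneg hp.le] at this
    linarith
  have hnw : ‖q • v + f‖ ≤ 11 / 10 * (‖v‖ * q) := by
    have := norm_add_le (q • v) f
    rw [norm_smul, Real.norm_of_nonneg hq.le] at this
    linarith
  have hprod : ‖p • v + e‖ * ‖q • v + f‖ ≤ 11 / 10 * (‖v‖ * p) * (11 / 10 * (‖v‖ * q)) := by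
    gcongr
  have hvf : -(‖v‖ * (‖v‖ / 10 * q)) ≤ inner ℝ v f :=
    (neg_le_neg (by gcongr)).trans (neg_le_of_abs_le (abs_real_inner_le_norm v f))
  have hev : -(‖v‖ / 10 * p * ‖v‖) ≤ inner ℝ e v :=
    (neg_le_neg (by gcongr)).trans (neg_le_of_abs_le (abs_real_inner_le_norm e v))
  have hef : -(‖v‖ / 10 * p * (‖v‖ / 10 * q)) ≤ inner ℝ e f :=
    (neg_le_neg (by gcongr)).trans (neg_le_of_abs_le (abs_real_inner_le_norm e f))
  have hexp : inner ℝ (p • v + e) (q • v + f)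
      = p * q * ‖v‖ ^ 2 + p * inner ℝ v f + q * inner ℝ e v + inner ℝ e f := by
    simp only [inner_add_left, inner_add_right, real_inner_smul_left, real_inner_smul_right,
      real_inner_self_eq_norm_sq]
    ring
  have hpvf := mul_le_mul_of_nonneg_left hvf hp.le
  have hqev := mul_le_mul_of_nonneg_left hev hq.le
  have hpos : 0 < p * q * ‖v‖ ^ 2 := by positivity
  rw [hexp]
  nlinarith

lemma two_pi_div_three_lt_angle {E : Type*} [NormedAddCommGroup E] [InnerProductSpace ℝ E]
    {x y z : E} (h : ‖y - x‖ * ‖z - y‖ < 2 * inner ℝ (y - x) (z - y)) :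
    2 * Real.pi / 3 < EuclideanGeometry.angle x y z := by
  by_contra! hle
  have hcos := Real.cos_le_cos_of_nonneg_of_le_pi (EuclideanGeometry.angle_nonneg x y z)
    (by linarith [Real.pi_pos]) hle
  have hval : Real.cos (2 * Real.pi / 3) = -(1 / 2) := by
    rw [show 2 * Real.pi / 3 = Real.pi - Real.pi / 3 by ring, Real.cos_pi_sub,
      Real.cos_pi_div_three]
  have hinner := InnerProductGeometry.cos_angle_mul_norm_mul_norm (x - y) (z - y)
  rw [← neg_sub y x, inner_neg_left, norm_neg, neg_sub] at hinner
  simp only [EuclideanGeometry.angle, vsub_eq_sub] at hcos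
  rw [hval] at hcos
  have := mul_le_mul_of_nonneg_right hcos (by positivity : 0 ≤ ‖y - x‖ * ‖z - y‖)
  linarith

/-- A curve with nonzero strict derivative at `t₀` only spans obtuse triangles near `t₀`. -/
lemma HasStrictDerivAt.exists_two_pi_div_three_lt_angle {E : Type*} [NormedAddCommGroup E]
    [InnerProductSpace ℝ E] {γ : ℝ → E} {v : E} {t₀ : ℝ} (h : HasStrictDerivAt γ v t₀)
    (hv : v ≠ 0) :
    ∃ η > 0, ∀ a b c, t₀ - η < a → a < b → b < c → c < t₀ + η →
      2 * Real.pi / 3 < EuclideanGeometry.angle (γ a) (γ b) (γ c) := by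
  have hv0 : 0 < ‖v‖ / 10 := by have := norm_pos_iff.mpr hv; positivity
  have hev := h.isLittleO.def hv0
  rw [Metric.eventually_nhds_iff] at hev
  obtain ⟨η, hη, hest⟩ := hev
  have hclose : ∀ a b, t₀ - η < a → a < b → b < t₀ + η →
      ‖γ b - γ a - (b - a) • v‖ ≤ ‖v‖ / 10 * (b - a) := by
    intro a b ha hab hb
    have := @hest (b, a) (by
      rw [Prod.dist_eq, Real.dist_eq, Real.dist_eq, max_lt_iff, abs_lt, abs_lt]
      refine ⟨⟨?_, ?_⟩, ?_, ?_⟩ <;> dsimp only <;> linarith)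
    simpa [abs_of_pos (sub_pos.mpr hab)] using this
  refine ⟨η, hη, fun a b c ha hab hbc hc => two_pi_div_three_lt_angle ?_⟩
  exact norm_mul_norm_lt_two_mul_inner (sub_pos.mpr hab) (sub_pos.mpr hbc) hv
    (hclose a b ha hab (hbc.trans hc)) (hclose b c (ha.trans hab) hbc hc)

/-- A simple closed curve is, near the image of `t₀`, traced out by parameters near `t₀`. -/
lemma Function.Periodic.exists_ball_subset_image_Ioo {E : Type*} [MetricSpace E] {γ : ℝ → E}
    (hper : Function.Periodic γ 1) (hγ : Continuous γ) (hinj : Set.InjOn γ (Set.Ico 0 1))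
    (t₀ : ℝ) {η : ℝ} (hη : 0 < η) :
    ∃ r > 0, ∀ t, dist (γ t) (γ t₀) < r → γ t ∈ γ '' Set.Ioo (t₀ - η) (t₀ + η) := by
  have hfract : ∀ s, γ (Int.fract s) = γ s := fun s => by
    rw [Int.fract, ← hper.sub_zsmul_eq (x := s) ⌊s⌋, zsmul_one]
  have hK : IsClosed (γ '' Set.Icc (t₀ + η) (t₀ + 1 - η)) := (isCompact_Icc.image hγ).isClosed
  have hnot : γ t₀ ∈ (γ '' Set.Icc (t₀ + η) (t₀ + 1 - η))ᶜ := by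
    rintro ⟨s, ⟨hs₁, hs₂⟩, hs⟩
    rw [← hfract s, ← hfract t₀] at hs
    obtain ⟨n, hn⟩ := Int.fract_eq_fract.mp (hinj ⟨Int.fract_nonneg _, Int.fract_lt_one _⟩
      ⟨Int.fract_nonneg _, Int.fract_lt_one _⟩ hs)
    have h₀ : (0 : ℝ) < n := by linarith
    have h₁ : (n : ℝ) < 1 := by linarith
    norm_cast at h₀ h₁
    omega
  obtain ⟨r, hr, hball⟩ := Metric.isOpen_iff.mp hK.isOpen_compl _ hnot
  refine ⟨r, hr, fun t ht => ?_⟩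
  obtain ⟨s, ⟨hs₁, hs₂⟩, hs⟩ := hper.exists_mem_Ioc one_pos t (t₀ - η)
  rw [hs] at ht ⊢
  refine ⟨s, ⟨hs₁, ?_⟩, rfl⟩
  by_contra! hle
  exact hball (Metric.mem_ball.mpr ht) ⟨s, ⟨hle, by linarith⟩, rfl⟩

theorem stmt_19 (N : ℕ) (hN : 2 ≤ N) (γ : ℝ → EuclideanSpace ℝ (Fin N))
    (hper : Function.Periodic γ 1) (hγ : ContDiff ℝ 3 γ)
    (hγ' : ∀ t : ℝ, deriv γ t ≠ 0) (hinj : Set.InjOn γ (Set.Ico 0 1)) :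
    ∃ ϱ > (0 : ℝ), ∀ x ∈ γ '' Set.Icc (0 : ℝ) 1, ∀ y ∈ γ '' Set.Icc (0 : ℝ) 1,
      ∀ z ∈ γ '' Set.Icc (0 : ℝ) 1,
      x ≠ y → y ≠ z → x ≠ z → dist x y < 2 * ϱ → dist z y < 2 * ϱ →
        (2 * Real.pi / 3 < EuclideanGeometry.angle y x z ∨
         2 * Real.pi / 3 < EuclideanGeometry.angle x y z ∨
         2 * Real.pi / 3 < EuclideanGeometry.angle x z y) := by
  have hlocal : ∀ t₀ : ℝ, ∃ r > 0, ∀ x ∈ Set.range γ, ∀ y ∈ Set.range γ, ∀ z ∈ Set.range γ,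
      x ≠ y → y ≠ z → x ≠ z → dist x (γ t₀) < r → dist y (γ t₀) < r → dist z (γ t₀) < r →
        (2 * Real.pi / 3 < EuclideanGeometry.angle y x z ∨
         2 * Real.pi / 3 < EuclideanGeometry.angle x y z ∨
         2 * Real.pi / 3 < EuclideanGeometry.angle x z y) := by
    intro t₀
    obtain ⟨η, hη, hangle⟩ := (hγ.contDiffAt.hasStrictDerivAt
      (by norm_num) : HasStrictDerivAt γ _ t₀).exists_two_pi_div_three_lt_angle (hγ' t₀)
    obtain ⟨r, hr, hball⟩ := hper.exists_ball_subset_image_Ioo hγ.continuous hinj t₀ hη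
    refine ⟨r, hr, ?_⟩
    rintro _ ⟨a, rfl⟩ _ ⟨b, rfl⟩ _ ⟨c, rfl⟩ hab hbc hac ha hb hc
    obtain ⟨a', ⟨ha₁, ha₂⟩, ha'⟩ := hball a ha
    obtain ⟨b', ⟨hb₁, hb₂⟩, hb'⟩ := hball b hb
    obtain ⟨c', ⟨hc₁, hc₂⟩, hc'⟩ := hball c hc
    rw [← ha', ← hb'] at hab
    rw [← hb', ← hc'] at hbc
    rw [← ha', ← hc'] at hac
    rw [← ha', ← hb', ← hc']
    rcases lt_or_gt_of_ne (ne_of_apply_ne γ hab) with h₁ | h₁ <;>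
      rcases lt_or_gt_of_ne (ne_of_apply_ne γ hbc) with h₂ | h₂ <;>
      rcases lt_or_gt_of_ne (ne_of_apply_ne γ hac) with h₃ | h₃
    · exact .inr (.inl (hangle a' b' c' ha₁ h₁ h₂ hc₂))
    · linarith
    · exact .inr (.inr (hangle a' c' b' ha₁ h₃ h₂ hb₂))
    · exact .inl (EuclideanGeometry.angle_comm (γ c') _ _ ▸ hangle c' a' b' hc₁ h₃ h₁ hb₂)
    · exact .inl (hangle b' a' c' hb₁ h₁ h₃ hc₂)
    · exact .inr (.inr (EuclideanGeometry.angle_comm (γ b') _ _ ▸ hangle b' c' a' hb₁ h₂ h₃ ha₂))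
    · linarith
    · exact .inr (.inl (EuclideanGeometry.angle_comm (γ c') _ _ ▸ hangle c' b' a' hc₁ h₂ h₁ ha₂))
  choose r hr hobtuse using hlocal
  obtain ⟨δ, hδ, hcover⟩ := lebesgue_number_lemma_of_metric
    (isCompact_Icc.image hγ.continuous : IsCompact (γ '' Set.Icc (0 : ℝ) 1))
    (c := fun t => Metric.ball (γ t) (r t)) (fun _ => Metric.isOpen_ball)
    (by
      rintro _ ⟨t, -, rfl⟩
      exact Set.mem_iUnion.mpr ⟨t, Metric.mem_ball_self (hr t)⟩)
  refine ⟨δ / 2, half_pos hδ, fun x hx y hy z hz hxy hyz hxz hdx hdz => ?_⟩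
  obtain ⟨t, ht⟩ := hcover y hy
  rw [mul_div_cancel₀ δ two_ne_zero] at hdx hdz
  have hrange := Set.image_subset_range γ (Set.Icc (0 : ℝ) 1)
  exact hobtuse t x (hrange hx) y (hrange hy) z (hrange hz) hxy hyz hxz
    (ht hdx) (ht (Metric.mem_ball_self hδ)) (ht hdz)
end
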